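/- arXiv:2605.18694 — 5 statements merged into one kernel-verified Lean document; each statement's English description precedes it below -/
import Mathlib

section
/- There is an absolute constant C > 0 such that, under assumptions (A1)–(A4), for every T ≥ 1 the AdaGrad-Norm iterates satisfy E[(1/T)∑_{t=1}^T ‖∇f(x_t)‖₂] ≤ C·[ (λ + Δ/γ + γ‖L‖_∞ ln K_T)/√T + ‖σ‖_p (ln K_T)^{1/p̄ + 1/2} / T^{(p−1)/p} + √((Δ/γ + γ‖L‖_∞ ln K_T)·‖σ‖_p) / T^{(p−1)/(2p)} + ‖σ‖_p (ln K_T)^{1/(2p̄) + 1/4} / T^{(3p−4)/(4p)} ], where Δ = f(x₁) − f_* and K_T = 1 + (√2·‖σ‖_p·T^{1/p} + 2‖∇f(x₁)‖₂·T^{1/2} + 2γ‖L‖_∞·T^{3/2})/λ. -/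
open MeasureTheory Finset

/-- The AdaGrad-Norm accumulator `v_t = ∑_{s=1}^t ‖g_s‖₂²`. -/
noncomputable def adaNormV {Ω : Type} {d : ℕ} (g : ℕ → Ω → EuclideanSpace ℝ (Fin d))
    (t : ℕ) (ω : Ω) : ℝ :=
  ∑ s ∈ Finset.Icc 1 t, ‖g s ω‖ ^ 2

/-- The natural filtration `F_t = σ(g_1, …, g_t)`. -/
noncomputable def natFilt {Ω : Type} [MeasurableSpace Ω] {d : ℕ}
    (g : ℕ → Ω → EuclideanSpace ℝ (Fin d)) (t : ℕ) : MeasurableSpace Ω :=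
  ⨆ s ∈ Finset.Icc 1 t, MeasurableSpace.comap (g s) inferInstance

section Deterministic

variable {E : Type*} [NormedAddCommGroup E] [InnerProductSpace ℝ E]

/-- A two-sided quadratic bound on the first-order Taylor remainder makes the gradient Lipschitz. -/
lemma norm_gradient_sub_le {f : E → ℝ} {G : E → E} {Λ : ℝ}
    (h : ∀ u v, |f u - f v - inner ℝ (G v) (u - v)| ≤ Λ / 2 * ‖u - v‖ ^ 2) (hΛ : 0 ≤ Λ) (u v : E) :
    ‖G u - G v‖ ≤ 3 * Λ * ‖u - v‖ := by
  by_cases hz : G u - G v = 0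
  · rw [hz, norm_zero]; positivity
  set n := ‖G u - G v‖ with hn
  have hn0 : 0 < n := norm_pos_iff.mpr hz
  set r := ‖u - v‖ with hr
  set e : E := (r / n) • (G u - G v) with he
  have hen : ‖e‖ = r := by
    rw [he, norm_smul, Real.norm_of_nonneg (by positivity), ← hn]
    field_simp
  have h1 := (abs_le.mp (h (u + e) u)).1
  have h2 := (abs_le.mp (h (u + e) v)).2
  have h3 := (abs_le.mp (h u v)).1
  rw [show u + e - u = e by abel, hen] at h1
  rw [show u + e - v = (u - v) + e by abel, inner_add_right] at h2
  have h4 : ‖(u - v) + e‖ ^ 2 ≤ (2 * r) ^ 2 := by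
    gcongr
    calc _ ≤ ‖u - v‖ + ‖e‖ := norm_add_le _ _
      _ = 2 * r := by rw [hen]; ring
  have h5 : inner ℝ (G u) e - inner ℝ (G v) e = r * n := by
    rw [← inner_sub_left, he, inner_smul_right, real_inner_self_eq_norm_sq, ← hn]
    field_simp
  have h6 : Λ / 2 * ‖(u - v) + e‖ ^ 2 ≤ Λ / 2 * (2 * r) ^ 2 := by gcongr
  have h7 : r * n ≤ r * (3 * Λ * r) := by nlinarith
  rcases (norm_nonneg (u - v)).eq_or_lt with h0 | h0
  · have : u = v := sub_eq_zero.mp (norm_eq_zero.mp h0.symm)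
    exact absurd (by simp [this]) hz
  · exact le_of_mul_le_mul_left h7 h0

/-- The logarithmic bound for normalised increments of `λ + √v`. -/
lemma sum_sq_div_le_log (a : ℕ → ℝ) {lam : ℝ} (hlam : 0 < lam) (T : ℕ) :
    ∑ t ∈ Icc 1 T, (a t / (lam + √(∑ s ∈ Icc 1 t, a s ^ 2))) ^ 2 ≤
      2 * Real.log ((lam + √(∑ s ∈ Icc 1 T, a s ^ 2)) / lam) := by
  induction T with
  | zero => simp [hlam.ne']
  | succ n ih =>
    rw [sum_Icc_succ_top (by lia)]
    set v := ∑ s ∈ Icc 1 n, a s ^ 2 with hv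
    have hv0 : 0 ≤ v := by positivity
    have hvs : ∑ s ∈ Icc 1 (n + 1), a s ^ 2 = v + a (n + 1) ^ 2 := sum_Icc_succ_top (by lia) _
    rw [hvs]
    set c := a (n + 1)
    set b := lam + √v with hb
    set b' := lam + √(v + c ^ 2) with hb'
    have hs : √v ≤ √(v + c ^ 2) := Real.sqrt_le_sqrt (by nlinarith [sq_nonneg c])
    have hb0 : 0 < b := by positivity
    have hb0' : 0 < b' := by positivity
    have h1 : c ^ 2 ≤ b' ^ 2 - b ^ 2 := by
      have e1 := Real.sq_sqrt hv0
      have e2 := Real.sq_sqrt (show 0 ≤ v + c ^ 2 by positivity)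
      rw [hb, hb']
      nlinarith
    have h2 : (c / b') ^ 2 ≤ 1 - b ^ 2 / b' ^ 2 := by
      rw [div_pow, div_le_iff₀ (by positivity)]
      field_simp
      exact h1
    have h3 := Real.one_sub_inv_le_log_of_pos (show 0 < (b' / b) ^ 2 by positivity)
    rw [Real.log_pow, ← inv_pow, inv_div, div_pow] at h3
    have h4 : Real.log (b' / lam) = Real.log (b' / b) + Real.log (b / lam) := by
      rw [← Real.log_mul (by positivity) (by positivity)]
      congr 1
      field_simp
    rw [h4]
    push_cast at h3
    linarith

lemma mul_le_rpow_add_sq {x u p : ℝ} (hx : 0 ≤ x) (hu : 0 ≤ u) (hu1 : u ≤ 1) (hp : 1 < p)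
    (hp2 : p ≤ 2) : x * u ≤ x ^ p + u ^ 2 := by
  have hxp : 0 ≤ x ^ p := by positivity
  rcases le_total x u with h | h
  · nlinarith
  · have : x * u ≤ x ^ p := by
      rcases le_total 1 x with h1 | h1
      · calc x * u ≤ x ^ (1 : ℝ) := by rw [Real.rpow_one]; nlinarith
          _ ≤ x ^ p := Real.rpow_le_rpow_of_exponent_le h1 hp.le
      · rcases hx.eq_or_lt with h0 | h0
        · rw [← h0, zero_mul]; positivity
        · calc x * u ≤ x ^ (2 : ℝ) := by rw [Real.rpow_two]; nlinarith
            _ ≤ x ^ p := Real.rpow_le_rpow_of_exponent_ge h0 h1 hp2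
    nlinarith [sq_nonneg u]

lemma abs_sqrt_add_sq_sub_le {v a b : ℝ} (hv : 0 ≤ v) (ha : 0 ≤ a) (hb : 0 ≤ b) :
    |√(v + a ^ 2) - √(v + b ^ 2)| ≤ |a - b| := by
  wlog hab : b ≤ a generalizing a b
  · rw [abs_sub_comm, abs_sub_comm a]
    exact this hb ha (le_of_not_ge hab)
  have h1 : √(v + b ^ 2) ≤ √(v + a ^ 2) := Real.sqrt_le_sqrt (by nlinarith)
  rw [abs_of_nonneg (by linarith), abs_of_nonneg (by linarith), sub_le_iff_le_add]
  apply Real.sqrt_le_iff.mpr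
  have hb' : b ≤ √(v + b ^ 2) := Real.le_sqrt_of_sq_le (by linarith)
  have e1 := Real.sq_sqrt (show 0 ≤ v + b ^ 2 by positivity)
  constructor
  · nlinarith
  · nlinarith

/-- Replacing the stepsize denominator `b` by a surrogate costs at most the listed terms. -/
lemma inner_div_le_inner_div_add {G g : E} {lam τ v p : ℝ} (hlam : 0 < lam) (hτ : 0 < τ)
    (hv : 0 ≤ v) (hp : 1 < p) (hp2 : p ≤ 2) :
    inner ℝ G g / (lam + τ + √(v + ‖G‖ ^ 2)) ≤
      inner ℝ G g / (lam + √(v + ‖g‖ ^ 2)) + ‖G‖ ^ 2 / (lam + τ + √(v + ‖G‖ ^ 2)) / 8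
        + 3 * τ * (‖g‖ / (lam + √(v + ‖g‖ ^ 2))) ^ 2
        + τ ^ (1 - p) * ((‖G‖ / (lam + τ + √(v + ‖G‖ ^ 2))) ^ p * ‖g - G‖ ^ p) := by
  set b := lam + √(v + ‖g‖ ^ 2) with hb
  set b' := lam + τ + √(v + ‖G‖ ^ 2) with hb'
  have hb0 : 0 < b := by positivity
  have hb0' : 0 < b' := by positivity
  set w := ‖G‖ / b' with hw
  set u := ‖g‖ / b with hu
  set X := ‖g - G‖ with hX
  have hu0 : 0 ≤ u := by positivity
  have hw0 : 0 ≤ w := by positivity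
  have hgb : ‖g‖ ≤ b := by
    have : ‖g‖ ≤ √(v + ‖g‖ ^ 2) := Real.le_sqrt_of_sq_le (by linarith)
    linarith
  have hu1 : u ≤ 1 := (div_le_one hb0).mpr hgb
  have hdiff : |b - b'| ≤ τ + X := by
    have h1 := abs_sqrt_add_sq_sub_le hv (norm_nonneg g) (norm_nonneg G)
    have h2 := abs_norm_sub_norm_le g G
    have h3 : b - b' = (√(v + ‖g‖ ^ 2) - √(v + ‖G‖ ^ 2)) + (-τ) := by rw [hb, hb']; ring
    calc |b - b'| ≤ |√(v + ‖g‖ ^ 2) - √(v + ‖G‖ ^ 2)| + |-τ| := by rw [h3]; exact abs_add_le _ _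
      _ ≤ τ + X := by rw [abs_neg, abs_of_pos hτ]; linarith
  have herr : inner ℝ G g / b' - inner ℝ G g / b ≤ w * u * (τ + X) := by
    calc inner ℝ G g / b' - inner ℝ G g / b = inner ℝ G g * (b - b') / (b' * b) := by
          field_simp
      _ ≤ |inner ℝ G g * (b - b')| / (b' * b) := by gcongr; exact le_abs_self _
      _ ≤ (‖G‖ * ‖g‖) * (τ + X) / (b' * b) := by
          rw [abs_mul]
          gcongr
          exact abs_real_inner_le_norm _ _
      _ = w * u * (τ + X) := by rw [hw, hu]; field_simp
  have hwτ : τ * w ^ 2 ≤ ‖G‖ ^ 2 / b' := by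
    rw [hw, div_pow, ← mul_div_assoc, div_le_div_iff₀ (by positivity) hb0']
    have : τ ≤ b' := by
      have := Real.sqrt_nonneg (v + ‖G‖ ^ 2)
      linarith
    have h3 : 0 ≤ ‖G‖ ^ 2 * b' := by positivity
    nlinarith
  have hY : w * u * X ≤ τ ^ (1 - p) * (w ^ p * X ^ p) + τ * u ^ 2 := by
    have h1 := mul_le_rpow_add_sq (x := w * X / τ) (by positivity) hu0 hu1 hp hp2
    have h2 : τ * (w * X / τ) ^ p = τ ^ (1 - p) * (w ^ p * X ^ p) := by
      rw [Real.div_rpow (by positivity) hτ.le, Real.mul_rpow hw0 (show 0 ≤ X from norm_nonneg _),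
        Real.rpow_sub hτ, Real.rpow_one]
      field_simp
    calc w * u * X = τ * (w * X / τ * u) := by field_simp
      _ ≤ τ * ((w * X / τ) ^ p + u ^ 2) := by gcongr
      _ = _ := by rw [mul_add, h2]
  have hT : w * u * τ ≤ τ * w ^ 2 / 8 + 2 * τ * u ^ 2 := by nlinarith [sq_nonneg (w / 4 - u)]
  nlinarith

end Deterministic

lemma sq_rpow_div_two {z : ℝ} (hz : 0 ≤ z) (p : ℝ) : (z ^ 2) ^ (p / 2) = z ^ p := by
  rw [← Real.rpow_natCast_mul hz]
  congr 1
  push_cast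
  ring

lemma rpow_sum_le_sum_rpow_of_le_one {ι : Type*} (s : Finset ι) {y : ι → ℝ} (hy : ∀ i, 0 ≤ y i)
    {q : ℝ} (hq : 0 < q) (hq1 : q ≤ 1) : (∑ i ∈ s, y i) ^ q ≤ ∑ i ∈ s, y i ^ q := by
  classical
  induction s using Finset.induction_on with
  | empty => simp [Real.zero_rpow hq.ne']
  | insert a s ha ih =>
    rw [sum_insert ha, sum_insert ha]
    have := Real.rpow_add_le_add_rpow (hy a) (sum_nonneg fun i (_ : i ∈ s) => hy i) hq.le hq1
    linarith

lemma norm_rpow_le_sum_abs_rpow {d : ℕ} (y : EuclideanSpace ℝ (Fin d)) {p : ℝ} (hp : 0 < p)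
    (hp2 : p ≤ 2) : ‖y‖ ^ p ≤ ∑ i, |y i| ^ p := by
  have h := rpow_sum_le_sum_rpow_of_le_one univ (y := fun i => |y i| ^ 2) (fun i => by positivity)
    (q := p / 2) (by positivity) (by linarith)
  simp only [sq_rpow_div_two (abs_nonneg _)] at h
  have h2 : ∑ i, |y i| ^ 2 = ‖y‖ ^ 2 := by simp [EuclideanSpace.norm_sq_eq]
  rwa [h2, sq_rpow_div_two (norm_nonneg _)] at h

/-- The `ℓ²` norm of a finite family of vectors, raised to the power `p ≤ 2`. -/
lemma sqrt_sum_sq_rpow_le {a : ℕ → ℝ} (ha : ∀ t, 0 ≤ a t) {p : ℝ} (hp : 0 < p) (hp2 : p ≤ 2)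
    (s : Finset ℕ) : √(∑ t ∈ s, a t ^ 2) ^ p ≤ ∑ t ∈ s, a t ^ p := by
  have h := rpow_sum_le_sum_rpow_of_le_one s (y := fun t => a t ^ 2) (fun i => by positivity)
    (q := p / 2) (by positivity) (by linarith)
  simp only [sq_rpow_div_two (ha _)] at h
  rwa [← Real.sq_sqrt (show 0 ≤ ∑ t ∈ s, a t ^ 2 by positivity),
    sq_rpow_div_two (Real.sqrt_nonneg _)] at h

lemma sqrt_sum_norm_sq_le {E : Type*} [NormedAddCommGroup E] (g G : ℕ → E) (s : Finset ℕ) :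
    √(∑ t ∈ s, ‖g t‖ ^ 2) ≤ 2 * √(∑ t ∈ s, ‖g t - G t‖ ^ 2) + 2 * √(∑ t ∈ s, ‖G t‖ ^ 2) := by
  have h1 : ∑ t ∈ s, ‖g t‖ ^ 2 ≤ 2 * ∑ t ∈ s, ‖g t - G t‖ ^ 2 + 2 * ∑ t ∈ s, ‖G t‖ ^ 2 := by
    rw [mul_sum, mul_sum, ← sum_add_distrib]
    refine sum_le_sum fun t _ => ?_
    have : ‖g t‖ ≤ ‖g t - G t‖ + ‖G t‖ := by simpa using norm_add_le (g t - G t) (G t)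
    nlinarith [sq_nonneg (‖g t - G t‖ - ‖G t‖), norm_nonneg (g t)]
  apply Real.sqrt_le_iff.mpr
  refine ⟨by positivity, ?_⟩
  have e1 := Real.sq_sqrt (show 0 ≤ ∑ t ∈ s, ‖g t - G t‖ ^ 2 by positivity)
  have e2 := Real.sq_sqrt (show 0 ≤ ∑ t ∈ s, ‖G t‖ ^ 2 by positivity)
  have e3 : 0 ≤ √(∑ t ∈ s, ‖g t - G t‖ ^ 2) * √(∑ t ∈ s, ‖G t‖ ^ 2) := by positivity
  nlinarith

lemma two_mul_sqrt_le_of_sum_div {a : ℕ → ℝ} {b : ℕ → ℝ} {s : Finset ℕ} {m θ : ℝ} (hm : 0 < m)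
    (hθ : 0 < θ) (hb : ∀ t ∈ s, 0 < b t ∧ b t ≤ m) :
    2 * √(∑ t ∈ s, a t ^ 2) ≤ θ * ∑ t ∈ s, a t ^ 2 / b t + m / θ := by
  have h1 : (∑ t ∈ s, a t ^ 2) / m ≤ ∑ t ∈ s, a t ^ 2 / b t := by
    rw [sum_div]
    refine sum_le_sum fun t ht => ?_
    have := (hb t ht).1
    have := (hb t ht).2
    gcongr
  set A := ∑ t ∈ s, a t ^ 2 with hA
  have e := Real.sq_sqrt (show 0 ≤ A by positivity)
  have h2 : 2 * √A ≤ θ * (A / m) + m / θ := by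
    rw [← sub_nonneg]
    have : θ * (A / m) + m / θ - 2 * √A = (θ * √A - m) ^ 2 / (m * θ) := by
      field_simp
      nlinarith
    rw [this]
    positivity
  calc 2 * √A ≤ θ * (A / m) + m / θ := h2
    _ ≤ _ := by gcongr

section Paths

variable {E : Type*} [NormedAddCommGroup E] [InnerProductSpace ℝ E]

/-- Telescoped descent along steps `x_{t+1} = x_t - (γ / b_t) g_t`. -/
lemma sum_inner_div_le {f : E → ℝ} {G : E → E} {Λ γ : ℝ} {x g : ℕ → E} {b : ℕ → ℝ}
    (h : ∀ u v, |f u - f v - inner ℝ (G v) (u - v)| ≤ Λ / 2 * ‖u - v‖ ^ 2)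
    (hγ : 0 < γ) (hb : ∀ t, 0 < b t)
    (hx : ∀ t, 1 ≤ t → x (t + 1) = x t - (γ / b t) • g t) (T : ℕ) :
    ∑ t ∈ Icc 1 T, inner ℝ (G (x t)) (g t) / b t ≤
      (f (x 1) - f (x (T + 1))) / γ + γ * Λ / 2 * ∑ t ∈ Icc 1 T, (‖g t‖ / b t) ^ 2 := by
  induction T with
  | zero => simp
  | succ n ih =>
    rw [sum_Icc_succ_top (by lia), sum_Icc_succ_top (by lia)]
    have h1 := (abs_le.mp (h (x (n + 1 + 1)) (x (n + 1)))).2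
    have hbn := hb (n + 1)
    rw [hx (n + 1) (by lia), sub_sub_cancel_left, inner_neg_right, inner_smul_right, norm_neg,
      norm_smul, Real.norm_of_nonneg (by positivity), ← hx (n + 1) (by lia)] at h1
    have h2 : inner ℝ (G (x (n + 1))) (g (n + 1)) / b (n + 1) ≤
        (f (x (n + 1)) - f (x (n + 1 + 1))) / γ
          + γ * Λ / 2 * (‖g (n + 1)‖ / b (n + 1)) ^ 2 := by
      have e1 : γ * (inner ℝ (G (x (n + 1))) (g (n + 1)) / b (n + 1)) ≤
          γ * ((f (x (n + 1)) - f (x (n + 1 + 1))) / γ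
          + γ * Λ / 2 * (‖g (n + 1)‖ / b (n + 1)) ^ 2) := by
        have e2 : γ * ((f (x (n + 1)) - f (x (n + 1 + 1))) / γ
            + γ * Λ / 2 * (‖g (n + 1)‖ / b (n + 1)) ^ 2) =
            (f (x (n + 1)) - f (x (n + 1 + 1)))
            + Λ / 2 * (γ / b (n + 1) * ‖g (n + 1)‖) ^ 2 := by field_simp
        rw [e2]
        have e3 : γ * (inner ℝ (G (x (n + 1))) (g (n + 1)) / b (n + 1)) =
          γ / b (n + 1) * inner ℝ (G (x (n + 1))) (g (n + 1)) := by ring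
        rw [e3]
        linarith
      exact le_of_mul_le_mul_left e1 hγ
    have h3 : (f (x 1) - f (x (n + 1 + 1))) / γ = (f (x 1) - f (x (n + 1))) / γ
        + (f (x (n + 1)) - f (x (n + 1 + 1))) / γ := by ring
    rw [mul_add, h3]
    linarith

lemma norm_iterate_sub_le {γ : ℝ} {x g : ℕ → E} {b : ℕ → ℝ} (hγ : 0 < γ)
    (hb : ∀ t, 0 < b t) (hgb : ∀ t, 1 ≤ t → ‖g t‖ ≤ b t)
    (hx : ∀ t, 1 ≤ t → x (t + 1) = x t - (γ / b t) • g t) (t : ℕ) (ht : 1 ≤ t) :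
    ‖x t - x 1‖ ≤ γ * t := by
  induction t, ht using Nat.le_induction with
  | base => simpa using hγ.le
  | succ n hn ih =>
    have h1 : ‖(γ / b n) • g n‖ ≤ γ := by
      have := hb n
      rw [norm_smul, Real.norm_of_nonneg (by positivity), div_mul_eq_mul_div, div_le_iff₀ this]
      exact mul_le_mul_of_nonneg_left (hgb n hn) hγ.le
    rw [hx n hn, show x n - (γ / b n) • g n - x 1 = (x n - x 1) - (γ / b n) • g n by abel]
    calc _ ≤ ‖x n - x 1‖ + ‖(γ / b n) • g n‖ := norm_sub_le _ _
      _ ≤ _ := by push_cast; linarith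

end Paths

/-- AdaGrad-Norm driven by unbiased stochastic gradients with bounded conditional `p`-th moments
of the noise. -/
structure IsAdaGradNorm {Ω : Type} [MeasurableSpace Ω] (μ : Measure Ω) {d : ℕ}
    (f : EuclideanSpace ℝ (Fin d) → ℝ)
    (G : EuclideanSpace ℝ (Fin d) → EuclideanSpace ℝ (Fin d))
    (g x : ℕ → Ω → EuclideanSpace ℝ (Fin d)) (x₁ : EuclideanSpace ℝ (Fin d))
    (γ lam p Λ s : ℝ) (σ : Fin d → ℝ) : Prop where
  γ_pos : 0 < γ
  lam_pos : 0 < lam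
  bddBelow : BddBelow (Set.range f)
  Λ_nonneg : 0 ≤ Λ
  smooth : ∀ u v, |f u - f v - inner ℝ (G v) (u - v)| ≤ Λ / 2 * ‖u - v‖ ^ 2
  measurable_g : ∀ t, Measurable (g t)
  integrable_g : ∀ t, Integrable (g t) μ
  init : ∀ ω, x 1 ω = x₁
  step : ∀ t, 1 ≤ t → ∀ ω,
    x (t + 1) ω = x t ω - (γ / (lam + √(adaNormV g t ω))) • g t ω
  unbiased : ∀ t, 1 ≤ t → ∀ i : Fin d,
    μ[(fun ω => g t ω i) | natFilt g (t - 1)] =ᵐ[μ] fun ω => G (x t ω) i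
  one_lt_p : 1 < p
  p_le_two : p ≤ 2
  noise : ∀ t, 1 ≤ t → ∀ i : Fin d,
    Integrable (fun ω => |g t ω i - G (x t ω) i| ^ p) μ ∧
    ∀ᵐ ω ∂μ, (μ[(fun ω' => |g t ω' i - G (x t ω') i| ^ p) | natFilt g (t - 1)]) ω ≤ σ i ^ p
  s_nonneg : 0 ≤ s
  s_rpow : s ^ p = ∑ i, σ i ^ p

section Accumulator

variable {Ω : Type} {d : ℕ} {g : ℕ → Ω → EuclideanSpace ℝ (Fin d)}

lemma measurable_adaNormV [MeasurableSpace Ω] {t : ℕ}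
    (hg : ∀ s, 1 ≤ s → s ≤ t → Measurable (g s)) : Measurable (adaNormV g t) := by
  refine Finset.measurable_fun_sum _ fun s hs => ?_
  rw [Finset.mem_Icc] at hs
  exact (hg s hs.1 hs.2).norm.pow_const 2

lemma adaNormV_nonneg (t : ℕ) (ω : Ω) : 0 ≤ adaNormV g t ω :=
  Finset.sum_nonneg fun _ _ => by positivity

lemma adaNormV_eq_add {t : ℕ} (ht : 1 ≤ t) (ω : Ω) :
    adaNormV g t ω = adaNormV g (t - 1) ω + ‖g t ω‖ ^ 2 := by
  obtain ⟨n, rfl⟩ : ∃ n, t = n + 1 := ⟨t - 1, by lia⟩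
  exact sum_Icc_succ_top (by lia) _

lemma adaNormV_mono {s t : ℕ} (h : s ≤ t) (ω : Ω) : adaNormV g s ω ≤ adaNormV g t ω :=
  sum_le_sum_of_subset_of_nonneg (Finset.Icc_subset_Icc_right h) fun _ _ _ => by positivity

lemma norm_le_sqrt_adaNormV {t : ℕ} (ht : 1 ≤ t) (ω : Ω) : ‖g t ω‖ ≤ √(adaNormV g t ω) := by
  refine Real.le_sqrt_of_sq_le ?_
  rw [adaNormV_eq_add ht]
  linarith [adaNormV_nonneg (g := g) (t - 1) ω]

end Accumulator

section Filtration

variable {Ω : Type} [mΩ : MeasurableSpace Ω] {d : ℕ} {g : ℕ → Ω → EuclideanSpace ℝ (Fin d)}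

lemma natFilt_le (hg : ∀ t, Measurable (g t)) (t : ℕ) : natFilt g t ≤ mΩ :=
  iSup₂_le fun s _ => (hg s).comap_le

lemma natFilt_mono {s t : ℕ} (h : s ≤ t) : natFilt g s ≤ natFilt g t :=
  biSup_mono fun _ hr => by
    rw [Finset.mem_Icc] at hr ⊢
    lia

lemma measurable_natFilt {s t : ℕ} (h1 : 1 ≤ s) (h : s ≤ t) : Measurable[natFilt g t] (g s) := by
  refine Measurable.of_comap_le ?_
  exact le_iSup₂_of_le (f := fun s (_ : s ∈ Finset.Icc 1 t) => MeasurableSpace.comap (g s) _)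
    s (Finset.mem_Icc.mpr ⟨h1, h⟩) le_rfl

lemma measurable_adaNormV_natFilt (t : ℕ) : Measurable[natFilt g t] (adaNormV g t) :=
  @measurable_adaNormV _ _ g (natFilt g t) t fun _ h1 h => measurable_natFilt h1 h

end Filtration

namespace IsAdaGradNorm

variable {Ω : Type} [mΩ : MeasurableSpace Ω] {μ : Measure Ω} {d : ℕ}
  {f : EuclideanSpace ℝ (Fin d) → ℝ}
  {G : EuclideanSpace ℝ (Fin d) → EuclideanSpace ℝ (Fin d)}
  {g x : ℕ → Ω → EuclideanSpace ℝ (Fin d)} {x₁ : EuclideanSpace ℝ (Fin d)}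
  {γ lam p Λ s : ℝ} {σ : Fin d → ℝ}

lemma denom_pos (h : IsAdaGradNorm μ f G g x x₁ γ lam p Λ s σ) (t : ℕ) (ω : Ω) :
    0 < lam + √(adaNormV g t ω) := by
  have := h.lam_pos
  positivity

lemma continuous_grad (h : IsAdaGradNorm μ f G g x x₁ γ lam p Λ s σ) : Continuous G := by
  have : LipschitzWith (3 * Λ).toNNReal G := LipschitzWith.of_dist_le' fun u v => by
    simpa only [dist_eq_norm] using norm_gradient_sub_le h.smooth h.Λ_nonneg u v
  exact this.continuous

lemma norm_grad_le (h : IsAdaGradNorm μ f G g x x₁ γ lam p Λ s σ) {t : ℕ} (ht : 1 ≤ t) (ω : Ω) :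
    ‖G (x t ω)‖ ≤ ‖G x₁‖ + 3 * Λ * (γ * t) := by
  have h1 : ‖x t ω - x 1 ω‖ ≤ γ * t :=
    norm_iterate_sub_le (x := fun t => x t ω) (g := fun t => g t ω) h.γ_pos
      (fun t => h.denom_pos t ω)
      (fun t ht => (norm_le_sqrt_adaNormV ht ω).trans (by linarith [h.lam_pos]))
      (fun t ht => h.step t ht ω) t ht
  rw [h.init] at h1
  have h2 := norm_gradient_sub_le h.smooth h.Λ_nonneg (x t ω) x₁
  have h3 : ‖G (x t ω)‖ ≤ ‖G x₁‖ + ‖G (x t ω) - G x₁‖ := by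
    simpa using norm_add_le (G x₁) (G (x t ω) - G x₁)
  have h4 : 3 * Λ * ‖x t ω - x₁‖ ≤ 3 * Λ * (γ * t) :=
    mul_le_mul_of_nonneg_left h1 (by linarith [h.Λ_nonneg])
  linarith

lemma measurable_iterate_natFilt (h : IsAdaGradNorm μ f G g x x₁ γ lam p Λ s σ) {t : ℕ}
    (ht : 1 ≤ t) : Measurable[natFilt g (t - 1)] (x t) := by
  induction t, ht using Nat.le_induction with
  | base =>
    have : x 1 = fun _ => x₁ := funext h.init
    rw [this]
    exact measurable_const
  | succ n hn ih =>
    have : x (n + 1) = fun ω => x n ω - (γ / (lam + √(adaNormV g n ω))) • g n ω :=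
      funext (h.step n hn)
    rw [this, Nat.add_sub_cancel]
    have m1 : Measurable[natFilt g n] (x n) := ih.mono (natFilt_mono (by lia)) le_rfl
    have m2 : Measurable[natFilt g n] (g n) := measurable_natFilt hn le_rfl
    have m3 : Measurable[natFilt g n] (adaNormV g n) := measurable_adaNormV_natFilt n
    exact m1.sub ((measurable_const.div (measurable_const.add m3.sqrt)).smul m2)

lemma measurable_grad_natFilt (h : IsAdaGradNorm μ f G g x x₁ γ lam p Λ s σ) {t : ℕ}
    (ht : 1 ≤ t) : Measurable[natFilt g (t - 1)] fun ω => G (x t ω) :=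
  h.continuous_grad.measurable.comp (h.measurable_iterate_natFilt ht)

lemma measurable_grad (h : IsAdaGradNorm μ f G g x x₁ γ lam p Λ s σ) {t : ℕ}
    (ht : 1 ≤ t) : Measurable fun ω => G (x t ω) :=
  (h.measurable_grad_natFilt ht).mono (natFilt_le h.measurable_g _) le_rfl

lemma sqrt_sum_norm_grad_sq_le (h : IsAdaGradNorm μ f G g x x₁ γ lam p Λ s σ) (T : ℕ) (ω : Ω) :
    √(∑ t ∈ Icc 1 T, ‖G (x t ω)‖ ^ 2) ≤ √T * (‖G x₁‖ + 3 * Λ * (γ * T)) := by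
  have h0 := h.Λ_nonneg
  have h1 := h.γ_pos
  have hB : 0 ≤ ‖G x₁‖ + 3 * Λ * (γ * T) := by positivity
  refine Real.sqrt_le_iff.mpr ⟨by positivity, ?_⟩
  rw [mul_pow, Real.sq_sqrt (by positivity)]
  calc ∑ t ∈ Icc 1 T, ‖G (x t ω)‖ ^ 2 ≤ ∑ t ∈ Icc 1 T, (‖G x₁‖ + 3 * Λ * (γ * T)) ^ 2 := by
        refine sum_le_sum fun t ht => ?_
        obtain ⟨ht1, htT⟩ := mem_Icc.mp ht
        have htT' : (t : ℝ) ≤ T := by exact_mod_cast htT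
        have : ‖G (x t ω)‖ ≤ ‖G x₁‖ + 3 * Λ * (γ * T) :=
          (h.norm_grad_le ht1 ω).trans (by gcongr)
        gcongr
    _ = _ := by simp

lemma measurable_denom (h : IsAdaGradNorm μ f G g x x₁ γ lam p Λ s σ) (t : ℕ) :
    Measurable fun ω => lam + √(adaNormV g t ω) :=
  measurable_const.add (measurable_adaNormV fun s _ _ => h.measurable_g s).sqrt

lemma norm_div_denom_le_one (h : IsAdaGradNorm μ f G g x x₁ γ lam p Λ s σ) {t : ℕ} (ht : 1 ≤ t)
    (ω : Ω) : ‖g t ω‖ / (lam + √(adaNormV g t ω)) ≤ 1 := by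
  rw [div_le_one (h.denom_pos t ω)]
  linarith [norm_le_sqrt_adaNormV (g := g) ht ω, h.lam_pos]

variable [IsProbabilityMeasure μ]

/-- Pulling a bounded predictable weight out of a conditional expectation, under the integral. -/
lemma integral_mul_condExp {m : MeasurableSpace Ω} (hm : m ≤ mΩ) {w Y : Ω → ℝ}
    (hw : Measurable[m] w) {c : ℝ} (hc : ∀ ω, |w ω| ≤ c) (hY : Integrable Y μ) :
    ∫ ω, w ω * Y ω ∂μ = ∫ ω, w ω * (μ[Y | m]) ω ∂μ := by
  have h1 : μ[w * Y | m] =ᵐ[μ] w * μ[Y | m] :=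
    condExp_stronglyMeasurable_mul_of_bound hm hw.stronglyMeasurable hY c
      (Filter.Eventually.of_forall hc)
  calc ∫ ω, w ω * Y ω ∂μ = ∫ ω, (μ[w * Y | m]) ω ∂μ := (integral_condExp hm).symm
    _ = _ := integral_congr_ae h1

lemma integral_weight_mul_inner (h : IsAdaGradNorm μ f G g x x₁ γ lam p Λ s σ) {t : ℕ}
    (ht : 1 ≤ t) {w : Ω → ℝ} (hw : Measurable[natFilt g (t - 1)] w) {c : ℝ}
    (hc : ∀ ω, |w ω| ≤ c) :
    Integrable (fun ω => w ω * inner ℝ (G (x t ω)) (g t ω)) μ ∧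
    ∫ ω, w ω * inner ℝ (G (x t ω)) (g t ω) ∂μ = ∫ ω, w ω * ‖G (x t ω)‖ ^ 2 ∂μ := by
  have hm := natFilt_le h.measurable_g (t - 1)
  set B := ‖G x₁‖ + 3 * Λ * (γ * t) with hB
  have hGm : ∀ i, Measurable[natFilt g (t - 1)] fun ω => G (x t ω) i := fun i =>
    (EuclideanSpace.proj (𝕜 := ℝ) i).continuous.measurable.comp (h.measurable_grad_natFilt ht)
  have hGb : ∀ i ω, |G (x t ω) i| ≤ B := fun i ω =>
    (PiLp.norm_apply_le (G (x t ω)) i).trans (h.norm_grad_le ht ω)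
  have hbd : ∀ i ω, |w ω * G (x t ω) i| ≤ c * B := fun i ω => by
    rw [abs_mul]
    exact mul_le_mul (hc ω) (hGb i ω) (abs_nonneg _) ((abs_nonneg _).trans (hc ω))
  have hgi : ∀ i, Integrable (fun ω => g t ω i) μ := fun i =>
    (EuclideanSpace.proj (𝕜 := ℝ) i).integrable_comp (h.integrable_g t)
  have hwm : ∀ i, Measurable[natFilt g (t - 1)] fun ω => w ω * G (x t ω) i := fun i =>
    hw.mul (hGm i)
  have hint : ∀ i, Integrable (fun ω => w ω * G (x t ω) i * g t ω i) μ := fun i =>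
    (hgi i).bdd_mul ((hwm i).mono hm le_rfl).aestronglyMeasurable
      (Filter.Eventually.of_forall (hbd i))
  have e1 : ∀ ω, w ω * inner ℝ (G (x t ω)) (g t ω) = ∑ i, w ω * G (x t ω) i * g t ω i := fun ω => by
    rw [PiLp.inner_apply, mul_sum]
    refine sum_congr rfl fun i _ => ?_
    simp only [RCLike.inner_apply, conj_trivial]
    ring
  have e2 : ∀ ω, w ω * ‖G (x t ω)‖ ^ 2 = ∑ i, w ω * G (x t ω) i * G (x t ω) i := fun ω => by
    rw [EuclideanSpace.norm_sq_eq, mul_sum]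
    refine sum_congr rfl fun i _ => ?_
    rw [Real.norm_eq_abs, sq_abs]
    ring
  have hint2 : ∀ i, Integrable (fun ω => w ω * G (x t ω) i * G (x t ω) i) μ := fun i =>
    Integrable.of_bound (((hwm i).mul (hGm i)).mono hm le_rfl).aestronglyMeasurable (c * B * B)
      (Filter.Eventually.of_forall fun ω => by
        rw [Real.norm_eq_abs, abs_mul]
        exact mul_le_mul (hbd i ω) (hGb i ω) (abs_nonneg _) ((abs_nonneg _).trans (hbd i ω)))
  simp only [e1, e2]
  refine ⟨integrable_finsetSum _ fun i _ => hint i, ?_⟩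
  rw [integral_finsetSum _ fun i _ => hint i, integral_finsetSum _ fun i _ => hint2 i]
  refine sum_congr rfl fun i _ => ?_
  rw [integral_mul_condExp hm (hwm i) (hbd i) (hgi i)]
  refine integral_congr_ae ?_
  filter_upwards [h.unbiased t ht i] with ω hω
  rw [hω]

lemma integral_weight_mul_noise_le (h : IsAdaGradNorm μ f G g x x₁ γ lam p Λ s σ) {t : ℕ}
    (ht : 1 ≤ t) {w : Ω → ℝ} (hw : Measurable[natFilt g (t - 1)] w) {c : ℝ}
    (hw0 : ∀ ω, 0 ≤ w ω) (hc : ∀ ω, w ω ≤ c) :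
    Integrable (fun ω => w ω * ‖g t ω - G (x t ω)‖ ^ p) μ ∧
    ∫ ω, w ω * ‖g t ω - G (x t ω)‖ ^ p ∂μ ≤ s ^ p * ∫ ω, w ω ∂μ := by
  have hm := natFilt_le h.measurable_g (t - 1)
  have hp0 : 0 < p := by linarith [h.one_lt_p]
  have hwm : Measurable w := hw.mono hm le_rfl
  have hwabs : ∀ ω, |w ω| ≤ c := fun ω => by rw [abs_of_nonneg (hw0 ω)]; exact hc ω
  have hwint : Integrable w μ :=
    Integrable.of_bound hwm.aestronglyMeasurable c (Filter.Eventually.of_forall hwabs)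
  have hint : ∀ i, Integrable (fun ω => w ω * |g t ω i - G (x t ω) i| ^ p) μ := fun i =>
    (h.noise t ht i).1.bdd_mul hwm.aestronglyMeasurable (Filter.Eventually.of_forall hwabs)
  have hle : ∀ ω, w ω * ‖g t ω - G (x t ω)‖ ^ p ≤ ∑ i, w ω * |g t ω i - G (x t ω) i| ^ p :=
    fun ω => by
      rw [← mul_sum]
      exact mul_le_mul_of_nonneg_left
        (norm_rpow_le_sum_abs_rpow (g t ω - G (x t ω)) hp0 h.p_le_two) (hw0 ω)
  have hsum : Integrable (fun ω => ∑ i, w ω * |g t ω i - G (x t ω) i| ^ p) μ :=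
    integrable_finsetSum _ fun i _ => hint i
  have hI : Integrable (fun ω => w ω * ‖g t ω - G (x t ω)‖ ^ p) μ := by
    refine hsum.mono' ?_ (Filter.Eventually.of_forall fun ω => ?_)
    · exact (hwm.mul (((h.measurable_g t).sub (h.measurable_grad ht)).norm.pow_const
        p)).aestronglyMeasurable
    · have := hw0 ω
      rw [Real.norm_of_nonneg (by positivity)]
      exact hle ω
  refine ⟨hI, (integral_mono hI hsum hle).trans ?_⟩
  rw [integral_finsetSum _ fun i _ => hint i, h.s_rpow, sum_mul]
  refine sum_le_sum fun i _ => ?_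
  rw [integral_mul_condExp hm hw hwabs (h.noise t ht i).1, ← integral_const_mul]
  refine integral_mono_ae ?_ (hwint.const_mul _) ?_
  · exact integrable_condExp.bdd_mul hwm.aestronglyMeasurable (Filter.Eventually.of_forall hwabs)
  · filter_upwards [(h.noise t ht i).2] with ω hω
    rw [mul_comm]
    exact mul_le_mul_of_nonneg_right hω (hw0 ω)

/-- The expected `ℓ²` size of the noise over `T` rounds. -/
lemma integral_sqrt_sum_noise_le (h : IsAdaGradNorm μ f G g x x₁ γ lam p Λ s σ) (T : ℕ) :
    Integrable (fun ω => √(∑ t ∈ Icc 1 T, ‖g t ω - G (x t ω)‖ ^ 2)) μ ∧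
    ∫ ω, √(∑ t ∈ Icc 1 T, ‖g t ω - G (x t ω)‖ ^ 2) ∂μ ≤ s * (T : ℝ) ^ (1 / p) := by
  have hp0 : 0 < p := by linarith [h.one_lt_p]
  set S : Ω → ℝ := fun ω => √(∑ t ∈ Icc 1 T, ‖g t ω - G (x t ω)‖ ^ 2) with hS
  have hSm : Measurable S := by
    refine (Finset.measurable_fun_sum _ fun t ht => ?_).sqrt
    exact ((h.measurable_g t).sub (h.measurable_grad (mem_Icc.mp ht).1)).norm.pow_const 2
  have hS0 : ∀ ω, 0 ≤ S ω := fun ω => Real.sqrt_nonneg _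
  have hn : ∀ t ∈ Icc 1 T, Integrable (fun ω => ‖g t ω - G (x t ω)‖ ^ p) μ ∧
      ∫ ω, ‖g t ω - G (x t ω)‖ ^ p ∂μ ≤ s ^ p := fun t ht => by
    simpa using h.integral_weight_mul_noise_le (mem_Icc.mp ht).1 (w := fun _ => 1)
      measurable_const (c := 1) (fun _ => zero_le_one) (fun _ => le_rfl)
  have hle : ∀ ω, S ω ^ p ≤ ∑ t ∈ Icc 1 T, ‖g t ω - G (x t ω)‖ ^ p := fun ω =>
    sqrt_sum_sq_rpow_le (a := fun t => ‖g t ω - G (x t ω)‖) (fun _ => norm_nonneg _) hp0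
      h.p_le_two _
  have hsum : Integrable (fun ω => ∑ t ∈ Icc 1 T, ‖g t ω - G (x t ω)‖ ^ p) μ :=
    integrable_finsetSum _ fun t ht => (hn t ht).1
  have hSp : Integrable (fun ω => S ω ^ p) μ := by
    refine hsum.mono' (hSm.pow_const p).aestronglyMeasurable
      (Filter.Eventually.of_forall fun ω => ?_)
    rw [Real.norm_of_nonneg (Real.rpow_nonneg (hS0 ω) p)]
    exact hle ω
  have hSi : Integrable S μ := by
    refine (hSp.add (integrable_const (1 : ℝ))).mono' hSm.aestronglyMeasurable
      (Filter.Eventually.of_forall fun ω => ?_)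
    rw [Real.norm_of_nonneg (hS0 ω)]
    have h1 := mul_le_rpow_add_sq (hS0 ω) zero_le_one le_rfl h.one_lt_p h.p_le_two
    simpa using h1
  refine ⟨hSi, ?_⟩
  have hJ : (∫ ω, S ω ∂μ) ^ p ≤ ∫ ω, S ω ^ p ∂μ :=
    (convexOn_rpow h.one_lt_p.le).map_integral_le
      (Real.continuous_rpow_const hp0.le).continuousOn isClosed_Ici
      (Filter.Eventually.of_forall hS0) hSi hSp
  have hB : ∫ ω, S ω ^ p ∂μ ≤ (s * (T : ℝ) ^ (1 / p)) ^ p := by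
    calc ∫ ω, S ω ^ p ∂μ ≤ ∫ ω, ∑ t ∈ Icc 1 T, ‖g t ω - G (x t ω)‖ ^ p ∂μ :=
          integral_mono hSp hsum hle
      _ = ∑ t ∈ Icc 1 T, ∫ ω, ‖g t ω - G (x t ω)‖ ^ p ∂μ :=
          integral_finsetSum _ fun t ht => (hn t ht).1
      _ ≤ ∑ t ∈ Icc 1 T, s ^ p := sum_le_sum fun t ht => (hn t ht).2
      _ = (s * (T : ℝ) ^ (1 / p)) ^ p := by
          rw [Real.mul_rpow h.s_nonneg (by positivity), ← Real.rpow_mul (by positivity),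
            one_div_mul_cancel hp0.ne', Real.rpow_one]
          simp [mul_comm]
  have := h.s_nonneg
  exact (Real.rpow_le_rpow_iff (integral_nonneg hS0) (by positivity) hp0).mp (hJ.trans hB)

lemma integrable_sq_div (h : IsAdaGradNorm μ f G g x x₁ γ lam p Λ s σ) {t : ℕ} (ht : 1 ≤ t) :
    Integrable (fun ω => (‖g t ω‖ / (lam + √(adaNormV g t ω))) ^ 2) μ := by
  refine Integrable.of_bound
    (((h.measurable_g t).norm.div (h.measurable_denom t)).pow_const 2).aestronglyMeasurable 1
    (Filter.Eventually.of_forall fun ω => ?_)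
  have := h.denom_pos t ω
  rw [Real.norm_of_nonneg (by positivity)]
  exact pow_le_one₀ (by positivity) (h.norm_div_denom_le_one ht ω)

lemma integrable_inner_div (h : IsAdaGradNorm μ f G g x x₁ γ lam p Λ s σ) {t : ℕ} (ht : 1 ≤ t) :
    Integrable (fun ω => inner ℝ (G (x t ω)) (g t ω) / (lam + √(adaNormV g t ω))) μ := by
  refine Integrable.of_bound
    (((h.measurable_grad ht).inner (h.measurable_g t)).div
      (h.measurable_denom t)).aestronglyMeasurable (‖G x₁‖ + 3 * Λ * (γ * t))
    (Filter.Eventually.of_forall fun ω => ?_)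
  have hd := h.denom_pos t ω
  rw [Real.norm_eq_abs, abs_div, abs_of_pos hd]
  calc _ ≤ ‖G (x t ω)‖ * ‖g t ω‖ / (lam + √(adaNormV g t ω)) := by
        gcongr
        exact abs_real_inner_le_norm _ _
    _ = ‖G (x t ω)‖ * (‖g t ω‖ / (lam + √(adaNormV g t ω))) := by ring
    _ ≤ ‖G (x t ω)‖ * 1 := by
        gcongr
        exact h.norm_div_denom_le_one ht ω
    _ ≤ _ := by rw [mul_one]; exact h.norm_grad_le ht ω

/-- Normalised squared stochastic gradients sum up to a logarithm in expectation. -/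
lemma integral_sum_sq_div_le (h : IsAdaGradNorm μ f G g x x₁ γ lam p Λ s σ) (T : ℕ) {m : ℝ}
    (hm : 1 + (2 * (s * (T : ℝ) ^ (1 / p)) + 2 * (√T * (‖G x₁‖ + 3 * Λ * (γ * T)))) / lam ≤ m) :
    ∫ ω, ∑ t ∈ Icc 1 T, (‖g t ω‖ / (lam + √(adaNormV g t ω))) ^ 2 ∂μ ≤ 2 * Real.log m := by
  have hlam := h.lam_pos
  have hs := h.s_nonneg
  have hΛ := h.Λ_nonneg
  have hγ := h.γ_pos
  set c := √T * (‖G x₁‖ + 3 * Λ * (γ * T)) with hc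
  have hc0 : 0 ≤ c := by positivity
  have hm1 : 1 ≤ m := le_trans (by
    have : 0 ≤ (2 * (s * (T : ℝ) ^ (1 / p)) + 2 * c) / lam := by positivity
    linarith) hm
  have hm0 : 0 < m := by linarith
  obtain ⟨hSi, hSb⟩ := h.integral_sqrt_sum_noise_le T
  set S : Ω → ℝ := fun ω => √(∑ t ∈ Icc 1 T, ‖g t ω - G (x t ω)‖ ^ 2) with hS
  have hpt : ∀ ω, ∑ t ∈ Icc 1 T, (‖g t ω‖ / (lam + √(adaNormV g t ω))) ^ 2 ≤
      2 * (Real.log m - 1) + 2 * ((1 + 2 * c / lam) / m) + 4 / (lam * m) * S ω := fun ω => by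
    have h1 := sum_sq_div_le_log (fun t => ‖g t ω‖) hlam T
    refine h1.trans ?_
    have hy0 : 0 < (lam + √(adaNormV g T ω)) / lam := div_pos (h.denom_pos T ω) hlam
    have h2 := Real.log_le_sub_one_of_pos (div_pos hy0 hm0)
    rw [Real.log_div hy0.ne' hm0.ne'] at h2
    have h3 : √(adaNormV g T ω) ≤ 2 * S ω + 2 * c :=
      (sqrt_sum_norm_sq_le (fun t => g t ω) (fun t => G (x t ω)) _).trans
        (by linarith [h.sqrt_sum_norm_grad_sq_le T ω])
    have h4 : (lam + √(adaNormV g T ω)) / lam / m ≤ (lam + (2 * S ω + 2 * c)) / lam / m := by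
      gcongr
    have h5 : (lam + (2 * S ω + 2 * c)) / lam / m =
        (1 + 2 * c / lam) / m + 2 / (lam * m) * S ω := by
      field_simp
      ring
    have h6 : 4 / (lam * m) * S ω = 2 * (2 / (lam * m) * S ω) := by ring
    change 2 * Real.log ((lam + √(adaNormV g T ω)) / lam) ≤ _
    linarith
  have hR : Integrable (fun ω =>
      2 * (Real.log m - 1) + 2 * ((1 + 2 * c / lam) / m) + 4 / (lam * m) * S ω) μ :=
    (integrable_const _).add (hSi.const_mul _)
  calc _ ≤ ∫ ω, (2 * (Real.log m - 1) + 2 * ((1 + 2 * c / lam) / m) + 4 / (lam * m) * S ω) ∂μ :=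
        integral_mono (integrable_finsetSum _ fun t ht => h.integrable_sq_div (mem_Icc.mp ht).1)
          hR hpt
    _ = 2 * (Real.log m - 1) + 2 * ((1 + 2 * c / lam) / m) + 4 / (lam * m) * ∫ ω, S ω ∂μ := by
        rw [integral_add (integrable_const _) (hSi.const_mul _), integral_const_mul,
          integral_const]
        simp
    _ ≤ 2 * (Real.log m - 1) + 2 * ((1 + 2 * c / lam) / m)
        + 4 / (lam * m) * (s * (T : ℝ) ^ (1 / p)) := by gcongr
    _ = 2 * (Real.log m - 1)
        + 2 * ((1 + (2 * (s * (T : ℝ) ^ (1 / p)) + 2 * c) / lam) / m) := by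
        field_simp
        ring
    _ ≤ 2 * (Real.log m - 1) + 2 * 1 := by
        gcongr
        exact (div_le_one hm0).mpr hm
    _ = 2 * Real.log m := by ring

end IsAdaGradNorm

/-- A predictable surrogate for the AdaGrad-Norm stepsize denominator. -/
noncomputable def surrogateDenom {Ω : Type} {d : ℕ}
    (G : EuclideanSpace ℝ (Fin d) → EuclideanSpace ℝ (Fin d))
    (g x : ℕ → Ω → EuclideanSpace ℝ (Fin d)) (lam τ : ℝ) (t : ℕ) (ω : Ω) : ℝ :=
  lam + τ + √(adaNormV g (t - 1) ω + ‖G (x t ω)‖ ^ 2)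

lemma rpow_mul_rpow_one_sub_le {w κ p : ℝ} (hw : 0 ≤ w) (hκ : 0 ≤ κ) (hp : 1 < p) (hp2 : p ≤ 2) :
    w ^ p * κ ^ (1 - p / 2) ≤ w ^ 2 + κ := by
  have h := Real.geom_mean_le_arith_mean2_weighted (w₁ := p / 2) (w₂ := 1 - p / 2)
    (by linarith) (by linarith) (sq_nonneg w) hκ (by ring)
  rw [sq_rpow_div_two hw] at h
  nlinarith [sq_nonneg w]

lemma sq_le_mul_of_forall_two_mul_le {R B m : ℝ} (hR : 0 ≤ R) (hB : 0 < B) (hm : 0 ≤ m)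
    (h : ∀ θ, 0 < θ → 2 * R ≤ θ * B + m / θ) : R ^ 2 ≤ B * m := by
  rcases hR.eq_or_lt with h0 | h0
  · rw [← h0, zero_pow two_ne_zero]
    positivity
  · have h1 := h (R / B) (by positivity)
    rw [div_mul_cancel₀ _ hB.ne', div_div_eq_mul_div] at h1
    have h2 : R ≤ m * B / R := by linarith
    rw [le_div_iff₀ h0] at h2
    linarith

namespace IsAdaGradNorm

variable {Ω : Type} [mΩ : MeasurableSpace Ω] {μ : Measure Ω} {d : ℕ}
  {f : EuclideanSpace ℝ (Fin d) → ℝ}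
  {G : EuclideanSpace ℝ (Fin d) → EuclideanSpace ℝ (Fin d)}
  {g x : ℕ → Ω → EuclideanSpace ℝ (Fin d)} {x₁ : EuclideanSpace ℝ (Fin d)}
  {γ lam p Λ s τ : ℝ} {σ : Fin d → ℝ}

lemma surrogateDenom_ge (h : IsAdaGradNorm μ f G g x x₁ γ lam p Λ s σ) (t : ℕ) (ω : Ω) :
    τ ≤ surrogateDenom G g x lam τ t ω := by
  have := Real.sqrt_nonneg (adaNormV g (t - 1) ω + ‖G (x t ω)‖ ^ 2)
  unfold surrogateDenom
  linarith [h.lam_pos]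

lemma surrogateDenom_pos (h : IsAdaGradNorm μ f G g x x₁ γ lam p Λ s σ) (hτ : 0 < τ) (t : ℕ)
    (ω : Ω) : 0 < surrogateDenom G g x lam τ t ω :=
  hτ.trans_le (h.surrogateDenom_ge t ω)

lemma measurable_surrogateDenom (h : IsAdaGradNorm μ f G g x x₁ γ lam p Λ s σ) {t : ℕ}
    (ht : 1 ≤ t) : Measurable[natFilt g (t - 1)] (surrogateDenom G g x lam τ t) := by
  have m1 := measurable_adaNormV_natFilt (g := g) (t - 1)
  have m2 := (measurable_norm.comp (h.measurable_grad_natFilt ht)).pow_const 2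
  exact measurable_const.add (m1.add m2).sqrt

variable [IsProbabilityMeasure μ]

lemma integrable_sq_div_surrogate (h : IsAdaGradNorm μ f G g x x₁ γ lam p Λ s σ) (hτ : 0 < τ)
    {t : ℕ} (ht : 1 ≤ t) :
    Integrable (fun ω => ‖G (x t ω)‖ ^ 2 / surrogateDenom G g x lam τ t ω) μ := by
  have hm := natFilt_le h.measurable_g (t - 1)
  refine Integrable.of_bound (((h.measurable_grad ht).norm.pow_const 2).div
    ((h.measurable_surrogateDenom ht).mono hm le_rfl)).aestronglyMeasurable
    ((‖G x₁‖ + 3 * Λ * (γ * t)) ^ 2 / τ) (Filter.Eventually.of_forall fun ω => ?_)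
  have h1 := h.surrogateDenom_pos hτ t ω
  rw [Real.norm_of_nonneg (by positivity)]
  have h2 := h.norm_grad_le ht ω
  have h3 := h.surrogateDenom_ge (τ := τ) t ω
  gcongr

/-- One round: the surrogate progress is controlled by the actual progress. -/
lemma integral_sq_div_surrogate_le (h : IsAdaGradNorm μ f G g x x₁ γ lam p Λ s σ) (hτ : 0 < τ)
    {κ : ℝ} (hκ : 0 ≤ κ) (hsκ : s ^ p ≤ τ ^ p / 8 * κ ^ (1 - p / 2)) {t : ℕ} (ht : 1 ≤ t) :
    3 / 4 * ∫ ω, ‖G (x t ω)‖ ^ 2 / surrogateDenom G g x lam τ t ω ∂μ ≤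
      ∫ ω, inner ℝ (G (x t ω)) (g t ω) / (lam + √(adaNormV g t ω)) ∂μ
        + 3 * τ * ∫ ω, (‖g t ω‖ / (lam + √(adaNormV g t ω))) ^ 2 ∂μ + τ * κ / 8 := by
  have hm := natFilt_le h.measurable_g (t - 1)
  have hp := h.one_lt_p
  have hlam := h.lam_pos
  set b : Ω → ℝ := surrogateDenom G g x lam τ t with hb
  have hbτ : ∀ ω, τ ≤ b ω := fun ω => h.surrogateDenom_ge t ω
  have hb0 : ∀ ω, 0 < b ω := fun ω => h.surrogateDenom_pos hτ t ω
  have hbm : Measurable[natFilt g (t - 1)] b := h.measurable_surrogateDenom ht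
  set w : Ω → ℝ := fun ω => ‖G (x t ω)‖ / b ω with hw
  have hw0 : ∀ ω, 0 ≤ w ω := fun ω => div_nonneg (norm_nonneg _) (hb0 ω).le
  have hw1 : ∀ ω, w ω ≤ 1 := fun ω => by
    rw [hw, div_le_one (hb0 ω)]
    have : ‖G (x t ω)‖ ≤ √(adaNormV g (t - 1) ω + ‖G (x t ω)‖ ^ 2) :=
      Real.le_sqrt_of_sq_le (by linarith [adaNormV_nonneg (g := g) (t - 1) ω])
    simp only [hb, surrogateDenom]
    linarith
  have hwm : Measurable[natFilt g (t - 1)] fun ω => w ω ^ p :=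
    ((measurable_norm.comp (h.measurable_grad_natFilt ht)).div hbm).pow_const p
  have hwp0 : ∀ ω, 0 ≤ w ω ^ p := fun ω => Real.rpow_nonneg (hw0 ω) p
  have hwp1 : ∀ ω, w ω ^ p ≤ 1 := fun ω => Real.rpow_le_one (hw0 ω) (hw1 ω) (by linarith)
  obtain ⟨hni, hnb⟩ := h.integral_weight_mul_noise_le ht hwm hwp0 hwp1
  have hbinv : Measurable[natFilt g (t - 1)] fun ω => (b ω)⁻¹ := hbm.inv
  have hbinvb : ∀ ω, |(b ω)⁻¹| ≤ τ⁻¹ := fun ω => by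
    have := hbτ ω
    rw [abs_of_pos (inv_pos.mpr (hb0 ω))]
    gcongr
  obtain ⟨hui, hub⟩ := h.integral_weight_mul_inner ht hbinv hbinvb
  have hai : Integrable (fun ω => ‖G (x t ω)‖ ^ 2 / b ω) μ := h.integrable_sq_div_surrogate hτ ht
  have hii := h.integrable_inner_div ht
  have hqi := h.integrable_sq_div ht
  have hwpi : Integrable (fun ω => w ω ^ p) μ :=
    Integrable.of_bound (hwm.mono hm le_rfl).aestronglyMeasurable 1
      (Filter.Eventually.of_forall fun ω => by
        rw [Real.norm_of_nonneg (hwp0 ω)]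
        exact hwp1 ω)
  have hI1 : Integrable (fun ω => inner ℝ (G (x t ω)) (g t ω) / (lam + √(adaNormV g t ω))
      + ‖G (x t ω)‖ ^ 2 / b ω / 8) μ := hii.add (hai.div_const 8)
  have hI2 : Integrable (fun ω => inner ℝ (G (x t ω)) (g t ω) / (lam + √(adaNormV g t ω))
      + ‖G (x t ω)‖ ^ 2 / b ω / 8
      + 3 * τ * (‖g t ω‖ / (lam + √(adaNormV g t ω))) ^ 2) μ := hI1.add (hqi.const_mul _)
  have hE : ∫ ω, ‖G (x t ω)‖ ^ 2 / b ω ∂μ ≤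
      ∫ ω, inner ℝ (G (x t ω)) (g t ω) / (lam + √(adaNormV g t ω)) ∂μ
        + (∫ ω, ‖G (x t ω)‖ ^ 2 / b ω ∂μ) / 8
        + 3 * τ * ∫ ω, (‖g t ω‖ / (lam + √(adaNormV g t ω))) ^ 2 ∂μ
        + τ ^ (1 - p) * ∫ ω, w ω ^ p * ‖g t ω - G (x t ω)‖ ^ p ∂μ := by
    calc ∫ ω, ‖G (x t ω)‖ ^ 2 / b ω ∂μ = ∫ ω, (b ω)⁻¹ * inner ℝ (G (x t ω)) (g t ω) ∂μ := by
          rw [hub]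
          simp only [div_eq_inv_mul]
      _ ≤ ∫ ω, (inner ℝ (G (x t ω)) (g t ω) / (lam + √(adaNormV g t ω))
            + ‖G (x t ω)‖ ^ 2 / b ω / 8
            + 3 * τ * (‖g t ω‖ / (lam + √(adaNormV g t ω))) ^ 2
            + τ ^ (1 - p) * (w ω ^ p * ‖g t ω - G (x t ω)‖ ^ p)) ∂μ := by
          refine integral_mono hui (hI2.add (hni.const_mul _)) fun ω => ?_
          have h1 := inner_div_le_inner_div_add (G := G (x t ω)) (g := g t ω) hlam hτ
            (adaNormV_nonneg (g := g) (t - 1) ω) hp h.p_le_two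
          rw [← adaNormV_eq_add ht] at h1
          exact (div_eq_inv_mul _ _).symm.trans_le h1
      _ = _ := by
          rw [integral_add hI2 (hni.const_mul _), integral_add hI1 (hqi.const_mul _),
            integral_add hii (hai.div_const 8), integral_const_mul, integral_const_mul,
            integral_div]
  have hN : τ ^ (1 - p) * ∫ ω, w ω ^ p * ‖g t ω - G (x t ω)‖ ^ p ∂μ ≤
      (∫ ω, ‖G (x t ω)‖ ^ 2 / b ω ∂μ) / 8 + τ * κ / 8 := by
    have hττ : τ ^ (1 - p) * (τ ^ p / 8 * κ ^ (1 - p / 2)) = τ / 8 * κ ^ (1 - p / 2) := by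
      rw [Real.rpow_sub hτ, Real.rpow_one]
      have := (Real.rpow_pos_of_pos hτ p).ne'
      field_simp
    have hwint := integral_nonneg (μ := μ) (f := fun ω => w ω ^ p) hwp0
    calc _ ≤ τ ^ (1 - p) * (s ^ p * ∫ ω, w ω ^ p ∂μ) := by gcongr
      _ ≤ τ ^ (1 - p) * ((τ ^ p / 8 * κ ^ (1 - p / 2)) * ∫ ω, w ω ^ p ∂μ) := by gcongr
      _ = ∫ ω, τ / 8 * κ ^ (1 - p / 2) * w ω ^ p ∂μ := by
          rw [← mul_assoc, hττ, integral_const_mul]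
      _ ≤ ∫ ω, (‖G (x t ω)‖ ^ 2 / b ω / 8 + τ * κ / 8) ∂μ := by
          refine integral_mono (hwpi.const_mul _) ((hai.div_const 8).add (integrable_const _))
            fun ω => ?_
          have h1 := rpow_mul_rpow_one_sub_le (hw0 ω) hκ hp h.p_le_two
          have h2 : τ * w ω ^ 2 ≤ ‖G (x t ω)‖ ^ 2 / b ω := by
            have hbp := hb0 ω
            calc τ * w ω ^ 2 ≤ b ω * w ω ^ 2 := by
                  have := hbτ ω
                  gcongr
              _ = ‖G (x t ω)‖ ^ 2 / b ω := by
                  simp only [hw]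
                  field_simp
          calc τ / 8 * κ ^ (1 - p / 2) * w ω ^ p = τ / 8 * (w ω ^ p * κ ^ (1 - p / 2)) := by ring
            _ ≤ τ / 8 * (w ω ^ 2 + κ) := by gcongr
            _ ≤ _ := by linarith
      _ = _ := by
          rw [integral_add (hai.div_const 8) (integrable_const _), integral_div, integral_const]
          simp
  linarith

/-- All rounds: the total surrogate progress. -/
lemma integral_sum_sq_div_surrogate_le (h : IsAdaGradNorm μ f G g x x₁ γ lam p Λ s σ)
    (hτ : 0 < τ) {κ : ℝ} (hκ : 0 ≤ κ) (hsκ : s ^ p ≤ τ ^ p / 8 * κ ^ (1 - p / 2)) (T : ℕ) :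
    3 / 4 * ∫ ω, ∑ t ∈ Icc 1 T, ‖G (x t ω)‖ ^ 2 / surrogateDenom G g x lam τ t ω ∂μ ≤
      (f x₁ - ⨅ y, f y) / γ + (γ * Λ / 2 + 3 * τ) *
        ∫ ω, ∑ t ∈ Icc 1 T, (‖g t ω‖ / (lam + √(adaNormV g t ω))) ^ 2 ∂μ + T * (τ * κ / 8) := by
  have hγ := h.γ_pos
  have h1 := sum_le_sum fun t (ht : t ∈ Icc 1 T) =>
    h.integral_sq_div_surrogate_le hτ hκ hsκ (mem_Icc.mp ht).1
  have hai : ∀ t ∈ Icc 1 T, _ := fun t ht => h.integrable_sq_div_surrogate hτ (mem_Icc.mp ht).1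
  have hii : ∀ t ∈ Icc 1 T, _ := fun t ht => h.integrable_inner_div (mem_Icc.mp ht).1
  have hqi : ∀ t ∈ Icc 1 T, _ := fun t ht => h.integrable_sq_div (mem_Icc.mp ht).1
  rw [sum_add_distrib, sum_add_distrib, ← mul_sum, ← mul_sum, ← integral_finsetSum _ hai,
    ← integral_finsetSum _ hii, ← integral_finsetSum _ hqi, sum_const, Nat.card_Icc,
    Nat.add_sub_cancel, nsmul_eq_mul] at h1
  have h2 : ∫ ω, ∑ t ∈ Icc 1 T, inner ℝ (G (x t ω)) (g t ω) / (lam + √(adaNormV g t ω)) ∂μ ≤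
      (f x₁ - ⨅ y, f y) / γ + γ * Λ / 2 *
        ∫ ω, ∑ t ∈ Icc 1 T, (‖g t ω‖ / (lam + √(adaNormV g t ω))) ^ 2 ∂μ := by
    have hq := integrable_finsetSum _ hqi
    calc _ ≤ ∫ ω, ((f x₁ - ⨅ y, f y) / γ + γ * Λ / 2 *
          ∑ t ∈ Icc 1 T, (‖g t ω‖ / (lam + √(adaNormV g t ω))) ^ 2) ∂μ := by
          refine integral_mono (integrable_finsetSum _ hii)
            ((integrable_const _).add (hq.const_mul _)) fun ω => ?_
          have h3 := sum_inner_div_le (x := fun t => x t ω) (g := fun t => g t ω) h.smooth hγ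
            (fun t => h.denom_pos t ω) (fun t ht => h.step t ht ω) T
          rw [h.init] at h3
          refine h3.trans ?_
          have : ⨅ y, f y ≤ f (x (T + 1) ω) := ciInf_le h.bddBelow _
          gcongr
      _ = _ := by
          rw [integral_add (integrable_const _) (hq.const_mul _), integral_const,
            integral_const_mul]
          simp
  linarith

lemma integrable_sqrt_sum_grad (h : IsAdaGradNorm μ f G g x x₁ γ lam p Λ s σ) (T : ℕ) :
    Integrable (fun ω => √(∑ t ∈ Icc 1 T, ‖G (x t ω)‖ ^ 2)) μ := by
  refine Integrable.of_bound (Measurable.aestronglyMeasurable ?_)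
    (√T * (‖G x₁‖ + 3 * Λ * (γ * T))) (Filter.Eventually.of_forall fun ω => ?_)
  · exact (Finset.measurable_fun_sum _ fun t ht =>
      (h.measurable_grad (mem_Icc.mp ht).1).norm.pow_const 2).sqrt
  · rw [Real.norm_of_nonneg (Real.sqrt_nonneg _)]
    exact h.sqrt_sum_norm_grad_sq_le T ω

/-- A self-bounding inequality for the expected `ℓ²` size of the gradients. -/
lemma sq_integral_sqrt_sum_grad_le (h : IsAdaGradNorm μ f G g x x₁ γ lam p Λ s σ)
    (hτ : 0 < τ) (T : ℕ) {B : ℝ} (hB : 0 < B)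
    (hB' : ∫ ω, ∑ t ∈ Icc 1 T, ‖G (x t ω)‖ ^ 2 / surrogateDenom G g x lam τ t ω ∂μ ≤ B) :
    (∫ ω, √(∑ t ∈ Icc 1 T, ‖G (x t ω)‖ ^ 2) ∂μ) ^ 2 ≤
      B * (lam + τ + 2 * (s * (T : ℝ) ^ (1 / p))
        + 3 * ∫ ω, √(∑ t ∈ Icc 1 T, ‖G (x t ω)‖ ^ 2) ∂μ) := by
  have hlam := h.lam_pos
  have hs := h.s_nonneg
  obtain ⟨hSi, hSb⟩ := h.integral_sqrt_sum_noise_le T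
  have hGi := h.integrable_sqrt_sum_grad T
  have hR0 : 0 ≤ ∫ ω, √(∑ t ∈ Icc 1 T, ‖G (x t ω)‖ ^ 2) ∂μ :=
    integral_nonneg fun ω => Real.sqrt_nonneg _
  refine sq_le_mul_of_forall_two_mul_le hR0 hB (by positivity) fun θ hθ => ?_
  have hai : Integrable (fun ω =>
      ∑ t ∈ Icc 1 T, ‖G (x t ω)‖ ^ 2 / surrogateDenom G g x lam τ t ω) μ :=
    integrable_finsetSum _ fun t ht => h.integrable_sq_div_surrogate hτ (mem_Icc.mp ht).1
  have hI : Integrable (fun ω =>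
      lam + τ + 2 * √(∑ t ∈ Icc 1 T, ‖g t ω - G (x t ω)‖ ^ 2)) μ :=
    (integrable_const _).add (hSi.const_mul 2)
  have hMi : Integrable (fun ω => lam + τ + 2 * √(∑ t ∈ Icc 1 T, ‖g t ω - G (x t ω)‖ ^ 2)
      + 3 * √(∑ t ∈ Icc 1 T, ‖G (x t ω)‖ ^ 2)) μ :=
    hI.add (hGi.const_mul 3)
  have hMe : ∫ ω, (lam + τ + 2 * √(∑ t ∈ Icc 1 T, ‖g t ω - G (x t ω)‖ ^ 2)
      + 3 * √(∑ t ∈ Icc 1 T, ‖G (x t ω)‖ ^ 2)) ∂μ =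
      lam + τ + 2 * ∫ ω, √(∑ t ∈ Icc 1 T, ‖g t ω - G (x t ω)‖ ^ 2) ∂μ
      + 3 * ∫ ω, √(∑ t ∈ Icc 1 T, ‖G (x t ω)‖ ^ 2) ∂μ := by
    rw [integral_add hI (hGi.const_mul 3),
      integral_add (integrable_const _) (hSi.const_mul 2), integral_const_mul,
      integral_const_mul, integral_const]
    simp
  rw [← integral_const_mul]
  calc _ ≤ ∫ ω, (θ * ∑ t ∈ Icc 1 T, ‖G (x t ω)‖ ^ 2 / surrogateDenom G g x lam τ t ω
        + (lam + τ + 2 * √(∑ t ∈ Icc 1 T, ‖g t ω - G (x t ω)‖ ^ 2)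
          + 3 * √(∑ t ∈ Icc 1 T, ‖G (x t ω)‖ ^ 2)) / θ) ∂μ := by
        refine integral_mono (hGi.const_mul 2) ((hai.const_mul θ).add (hMi.div_const θ))
          fun ω => ?_
        refine two_mul_sqrt_le_of_sum_div (a := fun t => ‖G (x t ω)‖) (by positivity) hθ
          fun t ht => ⟨h.surrogateDenom_pos hτ t ω, ?_⟩
        have h1 := sqrt_sum_norm_sq_le (fun t => g t ω) (fun t => G (x t ω)) (Icc 1 T)
        have h2 : √(adaNormV g (t - 1) ω) ≤ √(adaNormV g T ω) :=
          Real.sqrt_le_sqrt (adaNormV_mono (by have := (mem_Icc.mp ht).2; lia) ω)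
        have h3 : ‖G (x t ω)‖ ≤ √(∑ t ∈ Icc 1 T, ‖G (x t ω)‖ ^ 2) :=
          Real.le_sqrt_of_sq_le (single_le_sum (f := fun t => ‖G (x t ω)‖ ^ 2)
            (fun _ _ => by positivity) ht)
        have h4 : √(adaNormV g (t - 1) ω + ‖G (x t ω)‖ ^ 2) ≤
            √(adaNormV g (t - 1) ω) + ‖G (x t ω)‖ := by
          refine Real.sqrt_le_iff.mpr ⟨by positivity, ?_⟩
          have e := Real.sq_sqrt (adaNormV_nonneg (g := g) (t - 1) ω)
          have := mul_nonneg (Real.sqrt_nonneg (adaNormV g (t - 1) ω)) (norm_nonneg (G (x t ω)))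
          nlinarith
        unfold surrogateDenom
        change √(adaNormV g T ω) ≤ _ at h1
        linarith
    _ = θ * ∫ ω, ∑ t ∈ Icc 1 T, ‖G (x t ω)‖ ^ 2 / surrogateDenom G g x lam τ t ω ∂μ
        + (lam + τ + 2 * ∫ ω, √(∑ t ∈ Icc 1 T, ‖g t ω - G (x t ω)‖ ^ 2) ∂μ
          + 3 * ∫ ω, √(∑ t ∈ Icc 1 T, ‖G (x t ω)‖ ^ 2) ∂μ) / θ := by
        rw [integral_add (hai.const_mul θ) (hMi.div_const θ), integral_const_mul, integral_div,
          hMe]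
    _ ≤ _ := by gcongr

/-- The self-bounding inequality with all auxiliary quantities made explicit, where `ℓ` dominates
the logarithmic factor. -/
lemma sq_integral_sqrt_sum_grad_le_of_gt (h : IsAdaGradNorm μ f G g x x₁ γ lam p Λ s σ) {T : ℕ}
    (hT : 1 ≤ T) {ℓ : ℝ} (hℓ : 0 < ℓ)
    (hU : ∫ ω, ∑ t ∈ Icc 1 T, (‖g t ω‖ / (lam + √(adaNormV g t ω))) ^ 2 ∂μ ≤ 6 * ℓ)
    (hτ : 8 * s * ((T : ℝ) / ℓ) ^ ((2 - p) / (2 * p)) < τ) :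
    (∫ ω, √(∑ t ∈ Icc 1 T, ‖G (x t ω)‖ ^ 2) ∂μ) ^ 2 ≤
      25 * ((f x₁ - ⨅ y, f y) / γ + γ * Λ * ℓ + τ * ℓ) *
        (lam + τ + 2 * (s * (T : ℝ) ^ (1 / p))
          + 3 * ∫ ω, √(∑ t ∈ Icc 1 T, ‖G (x t ω)‖ ^ 2) ∂μ) := by
  have hs := h.s_nonneg
  have hΛ := h.Λ_nonneg
  have hγ := h.γ_pos
  have hp := h.one_lt_p
  have hp0 : 0 < p := by linarith
  have hT0 : (0 : ℝ) < T := by exact_mod_cast hT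
  have hτ0 : 0 < τ := lt_of_le_of_lt (by positivity) hτ
  have hΔ : 0 ≤ (f x₁ - ⨅ y, f y) / γ :=
    div_nonneg (sub_nonneg.mpr (ciInf_le h.bddBelow x₁)) hγ.le
  have hκ : s ^ p ≤ τ ^ p / 8 * (ℓ / T) ^ (1 - p / 2) := by
    have h1 : (8 * s * ((T : ℝ) / ℓ) ^ ((2 - p) / (2 * p))) ^ p ≤ τ ^ p :=
      Real.rpow_le_rpow (by positivity) hτ.le hp0.le
    rw [Real.mul_rpow (by positivity) (by positivity), Real.mul_rpow (by positivity) hs,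
      ← Real.rpow_mul (by positivity),
      show (2 - p) / (2 * p) * p = 1 - p / 2 by field_simp] at h1
    have h8 : (8 : ℝ) ≤ 8 ^ p := by
      simpa using Real.rpow_le_rpow_of_exponent_le (x := 8) (by norm_num) hp.le
    have h2 : ((T : ℝ) / ℓ) ^ (1 - p / 2) * (ℓ / T) ^ (1 - p / 2) = 1 := by
      rw [← Real.mul_rpow (by positivity) (by positivity), div_mul_div_cancel₀ hℓ.ne',
        div_self hT0.ne', Real.one_rpow]
    calc s ^ p = 8 * s ^ p * (((T : ℝ) / ℓ) ^ (1 - p / 2) * (ℓ / T) ^ (1 - p / 2)) / 8 := by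
          rw [h2]; ring
      _ ≤ 8 ^ p * s ^ p * (((T : ℝ) / ℓ) ^ (1 - p / 2) * (ℓ / T) ^ (1 - p / 2)) / 8 := by gcongr
      _ = 8 ^ p * s ^ p * ((T : ℝ) / ℓ) ^ (1 - p / 2) / 8 * (ℓ / T) ^ (1 - p / 2) := by ring
      _ ≤ _ := by gcongr
  have h1 := h.integral_sum_sq_div_surrogate_le hτ0 (by positivity) hκ T
  have h2 : (γ * Λ / 2 + 3 * τ) *
      ∫ ω, ∑ t ∈ Icc 1 T, (‖g t ω‖ / (lam + √(adaNormV g t ω))) ^ 2 ∂μ ≤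
      (γ * Λ / 2 + 3 * τ) * (6 * ℓ) := by gcongr
  have h3 : (T : ℝ) * (τ * (ℓ / T) / 8) = τ * ℓ / 8 := by field_simp
  have h4 : 0 < τ * ℓ := by positivity
  have h5 : 0 ≤ γ * Λ * ℓ := by positivity
  refine h.sq_integral_sqrt_sum_grad_le hτ0 T (by positivity) ?_
  nlinarith

lemma sq_integral_sqrt_sum_grad_le_threshold (h : IsAdaGradNorm μ f G g x x₁ γ lam p Λ s σ)
    {T : ℕ} (hT : 1 ≤ T) {ℓ : ℝ} (hℓ : 0 < ℓ)
    (hU : ∫ ω, ∑ t ∈ Icc 1 T, (‖g t ω‖ / (lam + √(adaNormV g t ω))) ^ 2 ∂μ ≤ 6 * ℓ)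
    (hτ : τ = 8 * s * ((T : ℝ) / ℓ) ^ ((2 - p) / (2 * p))) :
    (∫ ω, √(∑ t ∈ Icc 1 T, ‖G (x t ω)‖ ^ 2) ∂μ) ^ 2 ≤
      25 * ((f x₁ - ⨅ y, f y) / γ + γ * Λ * ℓ + τ * ℓ) *
        (lam + τ + 2 * (s * (T : ℝ) ^ (1 / p))
          + 3 * ∫ ω, √(∑ t ∈ Icc 1 T, ‖G (x t ω)‖ ^ 2) ∂μ) := by
  set R := ∫ ω, √(∑ t ∈ Icc 1 T, ‖G (x t ω)‖ ^ 2) ∂μ with hR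
  have hc : Continuous fun y : ℝ => 25 * ((f x₁ - ⨅ y, f y) / γ + γ * Λ * ℓ + y * ℓ) *
      (lam + y + 2 * (s * (T : ℝ) ^ (1 / p)) + 3 * R) := by fun_prop
  refine ge_of_tendsto ((hc.tendsto τ).mono_left (nhdsWithin_le_nhds (s := Set.Ioi τ))) ?_
  filter_upwards [self_mem_nhdsWithin] with y hy
  exact h.sq_integral_sqrt_sum_grad_le_of_gt hT hℓ hU (hτ ▸ hy)

end IsAdaGradNorm

lemma le_of_sq_le_mul_add {R A D lam τ S : ℝ} (hA : 0 ≤ A) (hD : 0 ≤ D) (hlam : 0 < lam)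
    (hτS : τ ≤ 8 * S) (hS : 0 ≤ S)
    (h : R ^ 2 ≤ 25 * (A + D) * (lam + τ + 2 * S + 3 * R)) :
    R ≤ 90 * (lam + A + D) + 16 * (√(A * S) + √(D * S)) := by
  have e1 := Real.sq_sqrt (mul_nonneg hA hS)
  have e2 := Real.sq_sqrt (mul_nonneg hD hS)
  have p1 := Real.sqrt_nonneg (A * S)
  have p2 := Real.sqrt_nonneg (D * S)
  by_contra! hlt
  set u := √(A * S)
  set v := √(D * S)
  have hR : 0 < R := by nlinarith
  have h1 : R ^ 2 ≤ 25 * (A + D) * lam + 250 * (u ^ 2 + v ^ 2) + 75 * (A + D) * R := by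
    have : 25 * (A + D) * τ ≤ 25 * (A + D) * (8 * S) := by gcongr
    nlinarith
  have h2 : R * (90 * (lam + A + D) + 16 * (u + v)) ≤ R * R := by gcongr
  have h3 : 25 * (A + D) * lam ≤ R * (15 * (lam + A + D)) := by
    have : 90 * (A + D) ≤ R := by nlinarith
    nlinarith
  have h4 : 16 * (u + v) * (16 * (u + v)) ≤ R * (16 * (u + v)) := by
    have : 16 * (u + v) ≤ R := by nlinarith
    gcongr
  nlinarith [mul_nonneg p1 p2, mul_pos hR hlam]

section Rates

variable {T ℓ p : ℝ}

lemma rpow_div_mul_eq_sqrt_mul (hT : 0 < T) (hℓ : 0 < ℓ) (hp : 1 < p) :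
    (T / ℓ) ^ ((2 - p) / (2 * p)) * ℓ =
      √T * (ℓ ^ (1 / (p / (p - 1)) + 1 / 2) / T ^ ((p - 1) / p)) := by
  have hp0 : p ≠ 0 := by linarith
  have hp1 : p - 1 ≠ 0 := by linarith
  have h1 : ℓ = ℓ ^ (1 / (p / (p - 1)) + 1 / 2) * ℓ ^ ((2 - p) / (2 * p)) := by
    rw [← Real.rpow_add hℓ, show 1 / (p / (p - 1)) + 1 / 2 + (2 - p) / (2 * p) = 1 by
      field_simp; ring, Real.rpow_one]
  have h2 : √T = T ^ ((2 - p) / (2 * p)) * T ^ ((p - 1) / p) := by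
    rw [Real.sqrt_eq_rpow, ← Real.rpow_add hT]
    congr 1
    field_simp
    ring
  have h3 := Real.rpow_pos_of_pos hℓ ((2 - p) / (2 * p))
  have h4 := Real.rpow_pos_of_pos hT ((p - 1) / p)
  rw [Real.div_rpow hT.le hℓ.le, h2]
  nth_rewrite 2 [h1]
  field_simp

lemma rpow_one_div_eq_sq (hT : 0 < T) (hp : 1 < p) :
    T ^ (1 / p) = (√T / T ^ ((p - 1) / (2 * p))) ^ 2 := by
  have hp0 : p ≠ 0 := by linarith
  rw [Real.sqrt_eq_rpow, ← Real.rpow_sub hT, ← Real.rpow_natCast, ← Real.rpow_mul hT.le]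
  congr 1
  push_cast
  field_simp
  ring

lemma rpow_div_mul_mul_rpow_eq_sq (hT : 0 < T) (hℓ : 0 < ℓ) (hp : 1 < p) :
    (T / ℓ) ^ ((2 - p) / (2 * p)) * ℓ * T ^ (1 / p) =
      (√T * (ℓ ^ (1 / (2 * (p / (p - 1))) + 1 / 4) / T ^ ((3 * p - 4) / (4 * p)))) ^ 2 := by
  have hp0 : p ≠ 0 := by linarith
  have hp1 : p - 1 ≠ 0 := by linarith
  have h1 : ℓ ^ (1 / (p / (p - 1)) + 1 / 2) = (ℓ ^ (1 / (2 * (p / (p - 1))) + 1 / 4)) ^ 2 := by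
    rw [← Real.rpow_natCast, ← Real.rpow_mul hℓ.le]
    congr 1
    push_cast
    field_simp
    ring
  have h2 : √T * T ^ (1 / p) / T ^ ((p - 1) / p) = (√T / T ^ ((3 * p - 4) / (4 * p))) ^ 2 := by
    rw [Real.sqrt_eq_rpow, ← Real.rpow_sub hT, ← Real.rpow_add hT, ← Real.rpow_sub hT,
      ← Real.rpow_natCast, ← Real.rpow_mul hT.le]
    congr 1
    push_cast
    field_simp
    ring
  calc _ = ℓ ^ (1 / (p / (p - 1)) + 1 / 2) * (√T * T ^ (1 / p) / T ^ ((p - 1) / p)) := by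
        rw [rpow_div_mul_eq_sqrt_mul hT hℓ hp]
        ring
    _ = _ := by
        rw [h1, h2]
        ring

lemma rpow_three_halves {T : ℝ} (hT : 0 ≤ T) : T ^ ((3 : ℝ) / 2) = T * √T := by
  rw [Real.sqrt_eq_rpow, show (3 : ℝ) / 2 = 1 + 1 / 2 by norm_num,
    Real.rpow_add_of_nonneg hT (by norm_num) (by norm_num), Real.rpow_one]

end Rates

namespace IsAdaGradNorm

variable {Ω : Type} [MeasurableSpace Ω] {μ : Measure Ω} [IsProbabilityMeasure μ] {d : ℕ}
  {f : EuclideanSpace ℝ (Fin d) → ℝ} {G : EuclideanSpace ℝ (Fin d) → EuclideanSpace ℝ (Fin d)}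
  {g x : ℕ → Ω → EuclideanSpace ℝ (Fin d)} {x₁ : EuclideanSpace ℝ (Fin d)}
  {γ lam p Λ s : ℝ} {σ : Fin d → ℝ}

lemma integral_average_norm_grad_le (h : IsAdaGradNorm μ f G g x x₁ γ lam p Λ s σ) {T : ℕ}
    (hT : 1 ≤ T) :
    ∫ ω, (1 / (T : ℝ)) * ∑ t ∈ Icc 1 T, ‖G (x t ω)‖ ∂μ ≤
      (∫ ω, √(∑ t ∈ Icc 1 T, ‖G (x t ω)‖ ^ 2) ∂μ) / √T := by
  have hT0 : (0 : ℝ) < T := by exact_mod_cast hT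
  rw [← integral_div]
  refine integral_mono_of_nonneg (Filter.Eventually.of_forall fun ω => by positivity)
    ((h.integrable_sqrt_sum_grad T).div_const _) (Filter.Eventually.of_forall fun ω => ?_)
  have h1 : ∑ t ∈ Icc 1 T, ‖G (x t ω)‖ ≤ √T * √(∑ t ∈ Icc 1 T, ‖G (x t ω)‖ ^ 2) := by
    rw [← Real.sqrt_mul hT0.le]
    refine Real.le_sqrt_of_sq_le ?_
    simpa using sq_sum_le_card_mul_sum_sq (s := Icc 1 T) (f := fun t => ‖G (x t ω)‖)
  have h2 := Real.sqrt_pos.mpr hT0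
  have h3 := Real.mul_self_sqrt hT0.le
  simp only
  rw [one_div_mul_eq_div, div_le_div_iff₀ hT0 h2]
  calc _ ≤ √T * √(∑ t ∈ Icc 1 T, ‖G (x t ω)‖ ^ 2) * √T := by gcongr
    _ = √(∑ t ∈ Icc 1 T, ‖G (x t ω)‖ ^ 2) * (√T * √T) := by ring
    _ = _ := by rw [h3]

lemma integral_sqrt_sum_grad_le_of_log_lt_one (h : IsAdaGradNorm μ f G g x x₁ γ lam p Λ s σ)
    {T : ℕ} {K : ℝ}
    (hK : K = 1 + (√2 * s * (T : ℝ) ^ (1 / p) + 2 * ‖G x₁‖ * (T : ℝ) ^ ((1 : ℝ) / 2) +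
      2 * γ * Λ * (T : ℝ) ^ ((3 : ℝ) / 2)) / lam)
    (hlog : Real.log K < 1) :
    ∫ ω, √(∑ t ∈ Icc 1 T, ‖G (x t ω)‖ ^ 2) ∂μ ≤ 3 * lam := by
  have hs := h.s_nonneg
  have hΛ := h.Λ_nonneg
  have hγ := h.γ_pos
  have hlam := h.lam_pos
  have hK1 : 1 ≤ K := by
    rw [hK]
    exact le_add_of_nonneg_right (by positivity)
  have hK3 : K < 3 :=
    ((Real.log_lt_iff_lt_exp (by linarith)).mp hlog).trans (Real.exp_one_lt_d9.trans (by norm_num))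
  have h1 : (√2 * s * (T : ℝ) ^ (1 / p) + 2 * ‖G x₁‖ * (T : ℝ) ^ ((1 : ℝ) / 2) +
      2 * γ * Λ * (T : ℝ) ^ ((3 : ℝ) / 2)) < 2 * lam := by
    rw [← div_lt_iff₀ hlam]
    linarith
  rw [rpow_three_halves T.cast_nonneg, ← Real.sqrt_eq_rpow] at h1
  have h2 : 0 ≤ √2 * s * (T : ℝ) ^ (1 / p) := by positivity
  have h3 : 0 ≤ ‖G x₁‖ * √T := by positivity
  have h4 : ∫ ω, √(∑ t ∈ Icc 1 T, ‖G (x t ω)‖ ^ 2) ∂μ ≤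
      ∫ _, √T * (‖G x₁‖ + 3 * Λ * (γ * T)) ∂μ :=
    integral_mono (h.integrable_sqrt_sum_grad T) (integrable_const _)
      (h.sqrt_sum_norm_grad_sq_le T)
  rw [integral_const, probReal_univ, one_smul] at h4
  linarith

lemma integral_sqrt_sum_grad_le_of_one_le_log (h : IsAdaGradNorm μ f G g x x₁ γ lam p Λ s σ)
    {T : ℕ} (hT : 1 ≤ T) {K : ℝ}
    (hK : K = 1 + (√2 * s * (T : ℝ) ^ (1 / p) + 2 * ‖G x₁‖ * (T : ℝ) ^ ((1 : ℝ) / 2) +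
      2 * γ * Λ * (T : ℝ) ^ ((3 : ℝ) / 2)) / lam)
    (hlog : 1 ≤ Real.log K) :
    ∫ ω, √(∑ t ∈ Icc 1 T, ‖G (x t ω)‖ ^ 2) ∂μ ≤
      1000 * (lam + (f x₁ - ⨅ y, f y) / γ + γ * Λ * Real.log K +
        √T * (s * (Real.log K ^ (1 / (p / (p - 1)) + 1 / 2) / (T : ℝ) ^ ((p - 1) / p))) +
        √T * (√(((f x₁ - ⨅ y, f y) / γ + γ * Λ * Real.log K) * s) /
          (T : ℝ) ^ ((p - 1) / (2 * p))) +
        √T * (s * (Real.log K ^ (1 / (2 * (p / (p - 1))) + 1 / 4) /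
          (T : ℝ) ^ ((3 * p - 4) / (4 * p))))) := by
  have hs := h.s_nonneg
  have hΛ := h.Λ_nonneg
  have hγ := h.γ_pos
  have hlam := h.lam_pos
  have hp := h.one_lt_p
  have hp2 := h.p_le_two
  have hT1 : (1 : ℝ) ≤ T := by exact_mod_cast hT
  have hT0 : (0 : ℝ) < T := by linarith
  have hΔ : 0 ≤ (f x₁ - ⨅ y, f y) / γ :=
    div_nonneg (sub_nonneg.mpr (ciInf_le h.bddBelow x₁)) hγ.le
  have hK1 : 1 ≤ K := by
    rw [hK]
    exact le_add_of_nonneg_right (by positivity)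
  have hm : 1 + (2 * (s * (T : ℝ) ^ (1 / p)) + 2 * (√T * (‖G x₁‖ + 3 * Λ * (γ * T)))) / lam ≤
      K ^ 3 := by
    have h1 : 1 + 3 * (K - 1) ≤ K ^ 3 := by nlinarith [sq_nonneg (K - 1)]
    refine le_trans ?_ h1
    rw [hK, rpow_three_halves hT0.le, ← Real.sqrt_eq_rpow, add_sub_cancel_left, ← mul_div_assoc]
    have h2 : (1 : ℝ) ≤ √2 := Real.one_le_sqrt.mpr (by norm_num)
    have h3 : s * (T : ℝ) ^ (1 / p) ≤ √2 * (s * (T : ℝ) ^ (1 / p)) :=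
      le_mul_of_one_le_left (by positivity) h2
    have h4 : 0 ≤ s * (T : ℝ) ^ (1 / p) := by positivity
    have h5 : 0 ≤ ‖G x₁‖ * √T := by positivity
    gcongr 1 + ?_ / lam
    linarith
  have hU := h.integral_sum_sq_div_le T hm
  rw [Real.log_pow] at hU
  push_cast at hU
  generalize Real.log K = ℓ at *
  have hℓ : 0 < ℓ := by linarith
  have hτS : 8 * s * ((T : ℝ) / ℓ) ^ ((2 - p) / (2 * p)) ≤ 8 * (s * (T : ℝ) ^ (1 / p)) := by
    have he : (2 - p) / (2 * p) ≤ 1 / p := by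
      rw [div_le_div_iff₀ (by linarith) (by linarith)]
      nlinarith
    have h1 : ((T : ℝ) / ℓ) ^ ((2 - p) / (2 * p)) ≤ (T : ℝ) ^ (1 / p) :=
      (Real.rpow_le_rpow (by positivity) (div_le_self hT0.le hlog)
        (div_nonneg (by linarith) (by linarith))).trans
        (Real.rpow_le_rpow_of_exponent_le hT1 he)
    rw [← mul_assoc]
    gcongr
  have hmain := le_of_sq_le_mul_add (A := (f x₁ - ⨅ y, f y) / γ + γ * Λ * ℓ) (by positivity)
    (by positivity) hlam hτS (by positivity)
    (h.sq_integral_sqrt_sum_grad_le_threshold hT hℓ (by linarith) rfl)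
  have hD : 8 * s * ((T : ℝ) / ℓ) ^ ((2 - p) / (2 * p)) * ℓ =
      8 * (√T * (s * (ℓ ^ (1 / (p / (p - 1)) + 1 / 2) / (T : ℝ) ^ ((p - 1) / p)))) := by
    rw [mul_assoc, rpow_div_mul_eq_sqrt_mul hT0 hℓ hp]
    ring
  have hAS : √(((f x₁ - ⨅ y, f y) / γ + γ * Λ * ℓ) * (s * (T : ℝ) ^ (1 / p))) =
      √T * (√(((f x₁ - ⨅ y, f y) / γ + γ * Λ * ℓ) * s) / (T : ℝ) ^ ((p - 1) / (2 * p))) := by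
    rw [← mul_assoc, Real.sqrt_mul (by positivity), rpow_one_div_eq_sq hT0 hp,
      Real.sqrt_sq (by positivity)]
    ring
  have hDS : √(8 * s * ((T : ℝ) / ℓ) ^ ((2 - p) / (2 * p)) * ℓ * (s * (T : ℝ) ^ (1 / p))) ≤
      3 * (√T * (s * (ℓ ^ (1 / (2 * (p / (p - 1))) + 1 / 4) /
        (T : ℝ) ^ ((3 * p - 4) / (4 * p))))) := by
    refine Real.sqrt_le_iff.mpr ⟨by positivity, ?_⟩
    calc _ = 8 * s ^ 2 * (((T : ℝ) / ℓ) ^ ((2 - p) / (2 * p)) * ℓ * (T : ℝ) ^ (1 / p)) := by ring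
      _ = 8 * (√T * (s * (ℓ ^ (1 / (2 * (p / (p - 1))) + 1 / 4) /
          (T : ℝ) ^ ((3 * p - 4) / (4 * p))))) ^ 2 := by
          rw [rpow_div_mul_mul_rpow_eq_sq hT0 hℓ hp]
          ring
      _ ≤ _ := by
          rw [mul_pow 3]
          gcongr
          norm_num
  rw [hD, hAS] at hmain
  rw [hD] at hDS
  have n1 : 0 ≤ √T * (s * (ℓ ^ (1 / (p / (p - 1)) + 1 / 2) / (T : ℝ) ^ ((p - 1) / p))) := by
    positivity
  have n2 : 0 ≤ √T * (√(((f x₁ - ⨅ y, f y) / γ + γ * Λ * ℓ) * s) /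
    (T : ℝ) ^ ((p - 1) / (2 * p))) := by positivity
  have n3 : 0 ≤ √T * (s * (ℓ ^ (1 / (2 * (p / (p - 1))) + 1 / 4) /
    (T : ℝ) ^ ((3 * p - 4) / (4 * p)))) := by positivity
  have n4 : 0 ≤ γ * Λ * ℓ := by positivity
  linarith

theorem integral_average_norm_grad_le_rate (h : IsAdaGradNorm μ f G g x x₁ γ lam p Λ s σ)
    {T : ℕ} (hT : 1 ≤ T) {K : ℝ}
    (hK : K = 1 + (√2 * s * (T : ℝ) ^ (1 / p) + 2 * ‖G x₁‖ * (T : ℝ) ^ ((1 : ℝ) / 2) +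
      2 * γ * Λ * (T : ℝ) ^ ((3 : ℝ) / 2)) / lam) :
    ∫ ω, (1 / (T : ℝ)) * ∑ t ∈ Icc 1 T, ‖G (x t ω)‖ ∂μ ≤
      1000 * ((lam + (f x₁ - ⨅ y, f y) / γ + γ * Λ * Real.log K) / √T +
        s * Real.log K ^ (1 / (p / (p - 1)) + 1 / 2) / (T : ℝ) ^ ((p - 1) / p) +
        √(((f x₁ - ⨅ y, f y) / γ + γ * Λ * Real.log K) * s) / (T : ℝ) ^ ((p - 1) / (2 * p)) +
        s * Real.log K ^ (1 / (2 * (p / (p - 1))) + 1 / 4) /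
          (T : ℝ) ^ ((3 * p - 4) / (4 * p))) := by
  have hs := h.s_nonneg
  have hΛ := h.Λ_nonneg
  have hγ := h.γ_pos
  have hlam := h.lam_pos
  have hT0 : (0 : ℝ) < T := by exact_mod_cast hT
  have hΔ : 0 ≤ (f x₁ - ⨅ y, f y) / γ :=
    div_nonneg (sub_nonneg.mpr (ciInf_le h.bddBelow x₁)) hγ.le
  have hK1 : 1 ≤ K := by
    rw [hK]
    exact le_add_of_nonneg_right (by positivity)
  have hlog := Real.log_nonneg hK1
  have hsT := Real.sqrt_pos.mpr hT0
  refine (h.integral_average_norm_grad_le hT).trans ?_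
  rw [div_le_iff₀ hsT]
  rcases lt_or_ge (Real.log K) 1 with hlt | hge
  · refine (h.integral_sqrt_sum_grad_le_of_log_lt_one hK hlt).trans ?_
    calc 3 * lam ≤ 1000 * (lam / √T) * √T := by
          rw [mul_assoc, div_mul_cancel₀ _ hsT.ne']
          linarith
      _ ≤ _ := by
          gcongr
          have n0 : lam / √T ≤ (lam + (f x₁ - ⨅ y, f y) / γ + γ * Λ * Real.log K) / √T := by
            gcongr
            rw [add_assoc]
            exact le_add_of_nonneg_right (by positivity)
          rw [add_assoc, add_assoc]
          exact n0.trans (le_add_of_nonneg_right (by positivity))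
  · refine (h.integral_sqrt_sum_grad_le_of_one_le_log hT hK hge).trans_eq ?_
    linear_combination
      -1000 * div_mul_cancel₀ (lam + (f x₁ - ⨅ y, f y) / γ + γ * Λ * Real.log K) hsT.ne'

end IsAdaGradNorm

/-- Coordinate-wise smoothness implies smoothness with respect to the Euclidean norm. -/
lemma abs_sub_sub_inner_le_of_coordinatewise {d : ℕ} {f : EuclideanSpace ℝ (Fin d) → ℝ}
    {G : EuclideanSpace ℝ (Fin d) → EuclideanSpace ℝ (Fin d)} {L : Fin d → ℝ}
    (hf : ∀ u v : EuclideanSpace ℝ (Fin d),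
      |f u - f v - ∑ i, G v i * (u i - v i)| ≤ 1 / 2 * ∑ i, L i * (u i - v i) ^ 2)
    (u v : EuclideanSpace ℝ (Fin d)) :
    |f u - f v - inner ℝ (G v) (u - v)| ≤ (⨆ i, L i) / 2 * ‖u - v‖ ^ 2 := by
  have h1 : inner ℝ (G v) (u - v) = ∑ i, G v i * (u i - v i) := by
    rw [PiLp.inner_apply]
    exact sum_congr rfl fun i _ => by simp [mul_comm]
  rw [h1, EuclideanSpace.real_norm_sq_eq]
  refine (hf u v).trans ?_
  have h2 : ∑ i, L i * (u i - v i) ^ 2 ≤ (⨆ i, L i) * ∑ i, (u - v) i ^ 2 := by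
    rw [mul_sum]
    refine sum_le_sum fun i _ => ?_
    rw [PiLp.sub_apply]
    gcongr
    exact le_ciSup (Set.finite_range L).bddAbove i
  linarith

/-- convergence rate of AdaGrad-Norm under heavy-tailed noise
(no boundedness of `f`).  There is an absolute constant `C > 0` such that,
under (A1)–(A4), for every `T ≥ 1`,
`E[(1/T)∑_{t=1}^T ‖∇f(x_t)‖₂]
  ≤ C·[(λ + Δ/γ + γ‖L‖_∞ ln K_T)/√T + ‖σ‖_p (ln K_T)^{1/p̄+1/2}/T^{(p−1)/p}
      + √((Δ/γ + γ‖L‖_∞ ln K_T)‖σ‖_p)/T^{(p−1)/(2p)}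
      + ‖σ‖_p (ln K_T)^{1/(2p̄)+1/4}/T^{(3p−4)/(4p)}]`,
where `Δ = f(x₁) − f_*`, `p̄ = p/(p−1)` and
`K_T = 1 + (√2‖σ‖_p T^{1/p} + 2‖∇f(x₁)‖₂ T^{1/2} + 2γ‖L‖_∞ T^{3/2})/λ`. -/
theorem adagradNorm_heavy_tailed_upper_bound :
    ∃ C : ℝ, 0 < C ∧
    ∀ (d : ℕ) (Ω : Type) [MeasurableSpace Ω] (μ : Measure Ω) [IsProbabilityMeasure μ]
      (f : EuclideanSpace ℝ (Fin d) → ℝ)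
      (gradf : EuclideanSpace ℝ (Fin d) → EuclideanSpace ℝ (Fin d))
      (g x : ℕ → Ω → EuclideanSpace ℝ (Fin d)) (x₁ : EuclideanSpace ℝ (Fin d))
      (γ lam p : ℝ) (L σ : Fin d → ℝ),
      0 < γ → 0 < lam →
      (∀ y, HasGradientAt f (gradf y) y) →
      -- (A1) lower boundedness
      BddBelow (Set.range f) →
      -- (A2) coordinate-wise smoothness
      (∀ i, 0 < L i) →
      (∀ u v : EuclideanSpace ℝ (Fin d),
        |f u - f v - ∑ i, gradf v i * (u i - v i)| ≤ 1 / 2 * ∑ i, L i * (u i - v i) ^ 2) →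
      (∀ t, Measurable (g t)) →
      (∀ t, Integrable (g t) μ) →
      -- AdaGrad-Norm dynamics
      (∀ ω, x 1 ω = x₁) →
      (∀ t, 1 ≤ t → ∀ ω,
        x (t + 1) ω = x t ω - (γ / (lam + Real.sqrt (adaNormV g t ω))) • g t ω) →
      -- (A3) unbiasedness
      (∀ t, 1 ≤ t → ∀ i : Fin d,
        μ[(fun ω => g t ω i) | natFilt g (t - 1)] =ᵐ[μ] fun ω => gradf (x t ω) i) →
      -- (A4) heavy-tailed noise
      1 < p → p ≤ 2 → (∀ i, 0 ≤ σ i) →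
      (∀ t, 1 ≤ t → ∀ i : Fin d,
        Integrable (fun ω => |g t ω i - gradf (x t ω) i| ^ p) μ ∧
        ∀ᵐ ω ∂μ,
          (μ[(fun ω' => |g t ω' i - gradf (x t ω') i| ^ p) | natFilt g (t - 1)]) ω ≤ σ i ^ p) →
      ∀ T : ℕ, 1 ≤ T →
      (∫ ω, (1 / (T : ℝ)) * ∑ t ∈ Finset.Icc 1 T, ‖gradf (x t ω)‖ ∂μ) ≤
        C * ((lam + (f x₁ - ⨅ y, f y) / γ +
                γ * (⨆ i, L i) * Real.log (1 + (Real.sqrt 2 * (∑ i, σ i ^ p) ^ (1 / p) * (T : ℝ) ^ (1 / p) +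
                  2 * ‖gradf x₁‖ * (T : ℝ) ^ ((1 : ℝ) / 2) +
                  2 * γ * (⨆ i, L i) * (T : ℝ) ^ ((3 : ℝ) / 2)) / lam)) / Real.sqrt (T : ℝ) +
              (∑ i, σ i ^ p) ^ (1 / p) *
                (Real.log (1 + (Real.sqrt 2 * (∑ i, σ i ^ p) ^ (1 / p) * (T : ℝ) ^ (1 / p) +
                  2 * ‖gradf x₁‖ * (T : ℝ) ^ ((1 : ℝ) / 2) +
                  2 * γ * (⨆ i, L i) * (T : ℝ) ^ ((3 : ℝ) / 2)) / lam)) ^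
                  (1 / (p / (p - 1)) + 1 / 2) / (T : ℝ) ^ ((p - 1) / p) +
              Real.sqrt (((f x₁ - ⨅ y, f y) / γ +
                γ * (⨆ i, L i) * Real.log (1 + (Real.sqrt 2 * (∑ i, σ i ^ p) ^ (1 / p) * (T : ℝ) ^ (1 / p) +
                  2 * ‖gradf x₁‖ * (T : ℝ) ^ ((1 : ℝ) / 2) +
                  2 * γ * (⨆ i, L i) * (T : ℝ) ^ ((3 : ℝ) / 2)) / lam)) *
                (∑ i, σ i ^ p) ^ (1 / p)) / (T : ℝ) ^ ((p - 1) / (2 * p)) +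
              (∑ i, σ i ^ p) ^ (1 / p) *
                (Real.log (1 + (Real.sqrt 2 * (∑ i, σ i ^ p) ^ (1 / p) * (T : ℝ) ^ (1 / p) +
                  2 * ‖gradf x₁‖ * (T : ℝ) ^ ((1 : ℝ) / 2) +
                  2 * γ * (⨆ i, L i) * (T : ℝ) ^ ((3 : ℝ) / 2)) / lam)) ^
                  (1 / (2 * (p / (p - 1))) + 1 / 4) / (T : ℝ) ^ ((3 * p - 4) / (4 * p))) := by
  refine ⟨1000, by norm_num, ?_⟩
  intro d Ω _ μ _ f gradf g x x₁ γ lam p L σ hγ hlam _ hbdd hL hsmooth hgm hgi hinit hstep hunb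
    hp hp2 hσ hnoise T hT
  have hσp : 0 ≤ ∑ i, σ i ^ p := sum_nonneg fun i _ => Real.rpow_nonneg (hσ i) p
  have h : IsAdaGradNorm μ f gradf g x x₁ γ lam p (⨆ i, L i) ((∑ i, σ i ^ p) ^ (1 / p)) σ :=
    { γ_pos := hγ
      lam_pos := hlam
      bddBelow := hbdd
      Λ_nonneg := Real.iSup_nonneg fun i => (hL i).le
      smooth := abs_sub_sub_inner_le_of_coordinatewise hsmooth
      measurable_g := hgm
      integrable_g := hgi
      init := hinit
      step := hstep
      unbiased := hunb
      one_lt_p := hp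
      p_le_two := hp2
      noise := hnoise
      s_nonneg := Real.rpow_nonneg hσp _
      s_rpow := by
        rw [← Real.rpow_mul hσp, one_div_mul_cancel (by linarith), Real.rpow_one] }
  exact h.integral_average_norm_grad_le_rate hT rfl
end

section
/- Under assumptions (A2)–(A4), for any vector c ∈ ℝ^d with c_i > 0 for all i and any t ≥ 1, the AdaGrad iterates satisfy (γ/2)·E[∑_{i=1}^d (∇_i f(x_t))²/(λ + √w_{t,i})] ≤ E[f(x_t) − f(x_{t+1})] + γ·∑_{i=1}^d (σ_i²/c_i)·(E[g_{t,i}²/(λ² + v_{t,i})])^{2/p̄} + γ·∑_{i=1}^d (c_i + γL_i/2)·E[g_{t,i}²/(λ² + v_{t,i})], where the proxy stepsize is w_{t,i} = v_{t−1,i} + (∇_i f(x_t))² + c_i². -/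
open MeasureTheory Finset

/-- The AdaGrad accumulator `v_{t,i} = ∑_{s=1}^t g_{s,i}²`. -/
noncomputable def adaV {Ω : Type} {d : ℕ} (g : ℕ → Ω → EuclideanSpace ℝ (Fin d))
    (t : ℕ) (ω : Ω) (i : Fin d) : ℝ :=
  ∑ s ∈ Finset.Icc 1 t, (g s ω i) ^ 2

section Helpers

variable {Ω : Type*} {m m₀ : MeasurableSpace Ω} {μ : Measure Ω} [IsProbabilityMeasure μ]

lemma integral_mul_condExp_of_abs_le_one (hm : m ≤ m₀) {B X : Ω → ℝ}
    (hB : Measurable[m] B) (hB1 : ∀ ω, |B ω| ≤ 1) (hX : Integrable X μ) :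
    ∫ ω, B ω * X ω ∂μ = ∫ ω, B ω * (μ[X | m]) ω ∂μ := by
  have hint : Integrable (B * X) μ :=
    hX.bdd_mul (c := 1) (hB.mono hm le_rfl).aestronglyMeasurable (.of_forall hB1)
  calc ∫ ω, B ω * X ω ∂μ = ∫ ω, (μ[B * X | m]) ω ∂μ := (integral_condExp hm).symm
    _ = ∫ ω, B ω * (μ[X | m]) ω ∂μ :=
      integral_congr_ae (condExp_mul_of_stronglyMeasurable_left hB.stronglyMeasurable hint hX)

lemma integrable_of_abs_le_one {A : Ω → ℝ} (hA : Measurable A) (hA1 : ∀ ω, |A ω| ≤ 1) :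
    Integrable A μ :=
  .of_bound hA.aestronglyMeasurable 1 (.of_forall hA1)

lemma integral_rpow_le_integral_sq_rpow {A : Ω → ℝ} (hA : Measurable A)
    (hA0 : ∀ ω, 0 ≤ A ω) (hA1 : ∀ ω, A ω ≤ 1) {p : ℝ} (hp0 : 0 ≤ p) (hp2 : p ≤ 2) :
    ∫ ω, A ω ^ p ∂μ ≤ (∫ ω, A ω ^ 2 ∂μ) ^ (p / 2) := by
  have hpow : ∀ ω, (A ω ^ 2) ^ (p / 2) = A ω ^ p := fun ω => by
    rw [← Real.rpow_natCast, ← Real.rpow_mul (hA0 ω)]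
    congr 1
    push_cast
    ring
  have hsq : Integrable (fun ω => A ω ^ 2) μ :=
    integrable_of_abs_le_one (hA.pow_const 2) fun ω => by
      rw [abs_of_nonneg (sq_nonneg _)]
      exact pow_le_one₀ (hA0 ω) (hA1 ω)
  have hp : Integrable (fun ω => A ω ^ p) μ :=
    integrable_of_abs_le_one (hA.pow_const p) fun ω => by
      rw [abs_of_nonneg (Real.rpow_nonneg (hA0 ω) _)]
      exact Real.rpow_le_one (hA0 ω) (hA1 ω) hp0
  have key := (Real.concaveOn_rpow (p := p / 2) (by linarith) (by linarith)).le_map_integral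
    (μ := μ) (f := fun ω => A ω ^ 2)
    (Real.continuous_rpow_const (by linarith)).continuousOn isClosed_Ici
    (.of_forall fun ω => sq_nonneg (A ω)) hsq (by simpa [Function.comp_def, hpow] using hp)
  simpa only [hpow] using key

lemma integral_mul_abs_rpow_le_of_condExp_le (hm : m ≤ m₀) {A ξ : Ω → ℝ} {p s : ℝ} (hp0 : 0 ≤ p)
    (hA : Measurable[m] A) (hA0 : ∀ ω, 0 ≤ A ω) (hA1 : ∀ ω, A ω ≤ 1)
    (hξ : Integrable (fun ω => |ξ ω| ^ p) μ)
    (hs : ∀ᵐ ω ∂μ, (μ[fun ω => |ξ ω| ^ p | m]) ω ≤ s) :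
    ∫ ω, (A ω * |ξ ω|) ^ p ∂μ ≤ s * ∫ ω, A ω ^ p ∂μ := by
  have hApm : Measurable[m] fun ω => A ω ^ p := hA.pow_const p
  have hAp1 : ∀ ω, |A ω ^ p| ≤ 1 := fun ω => by
    rw [abs_of_nonneg (Real.rpow_nonneg (hA0 ω) _)]
    exact Real.rpow_le_one (hA0 ω) (hA1 ω) hp0
  have hApm₀ : Measurable fun ω => A ω ^ p := hApm.mono hm le_rfl
  simp_rw [fun ω => Real.mul_rpow (z := p) (hA0 ω) (abs_nonneg (ξ ω))]
  rw [integral_mul_condExp_of_abs_le_one hm hApm hAp1 hξ, ← integral_const_mul]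
  refine integral_mono_ae
    (integrable_condExp.bdd_mul (c := 1) hApm₀.aestronglyMeasurable (.of_forall hAp1))
    ((integrable_of_abs_le_one hApm₀ hAp1).const_mul s) ?_
  filter_upwards [hs] with ω hω
  rw [mul_comm s]
  exact mul_le_mul_of_nonneg_left hω (Real.rpow_nonneg (hA0 ω) _)

/-- Hölder's inequality followed by Young's inequality for noise whose conditional `p`-th moment
is bounded by `σ ^ p`. -/
lemma integral_mul_noise_mul_le (hm : m ≤ m₀) {A ξ h : Ω → ℝ} {p σ c : ℝ}
    (hp1 : 1 < p) (hp2 : p ≤ 2) (hσ : 0 ≤ σ) (hc : 0 < c)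
    (hA : Measurable[m] A) (hA0 : ∀ ω, 0 ≤ A ω) (hA1 : ∀ ω, A ω ≤ 1)
    (hh : Measurable h) (hh0 : ∀ ω, 0 ≤ h ω) (hh1 : ∀ ω, h ω ≤ 1)
    (hξm : Measurable ξ) (hξ : Integrable (fun ω => |ξ ω| ^ p) μ)
    (hs : ∀ᵐ ω ∂μ, (μ[fun ω => |ξ ω| ^ p | m]) ω ≤ σ ^ p) :
    ∫ ω, A ω * |ξ ω| * h ω ∂μ ≤
      c / 4 * ∫ ω, A ω ^ 2 ∂μ + σ ^ 2 / c * (∫ ω, h ω ^ 2 ∂μ) ^ (2 / (p / (p - 1))) := by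
  set q := p / (p - 1) with hq
  have hp0 : 0 < p := by linarith
  have hpq : p.HolderConjugate q := Real.HolderConjugate.conjExponent hp1
  have hq0 : 0 < q := hpq.symm.pos
  have hq2 : 2 ≤ q := by
    rw [hq, le_div_iff₀ (by linarith)]
    linarith
  have hAm₀ : Measurable A := hA.mono hm le_rfl
  have hprod : Measurable fun ω => A ω * |ξ ω| := hAm₀.mul (by fun_prop)
  have hprod_mem : MemLp (fun ω => A ω * |ξ ω|) (ENNReal.ofReal p) μ := by
    rw [← integrable_norm_rpow_iff hprod.aestronglyMeasurable (by simpa using hp0) (by simp),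
      ENNReal.toReal_ofReal hp0.le]
    refine hξ.mono' (hprod.norm.pow_const p).aestronglyMeasurable (.of_forall fun ω => ?_)
    rw [Real.norm_of_nonneg (by positivity), norm_mul, Real.norm_of_nonneg (hA0 ω), norm_abs_eq_norm,
      Real.norm_eq_abs]
    exact Real.rpow_le_rpow (mul_nonneg (hA0 ω) (abs_nonneg _))
      (mul_le_of_le_one_left (abs_nonneg _) (hA1 ω)) hp0.le
  have hh_abs : ∀ ω, ‖h ω‖ ≤ 1 := fun ω => by rw [Real.norm_of_nonneg (hh0 ω)]; exact hh1 ω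
  have hh_mem : MemLp h (ENNReal.ofReal q) μ :=
    .of_bound hh.aestronglyMeasurable 1 (.of_forall hh_abs)
  have holder := integral_mul_le_Lp_mul_Lq_of_nonneg hpq
    (.of_forall fun ω => mul_nonneg (hA0 ω) (abs_nonneg (ξ ω))) (.of_forall hh0) hprod_mem hh_mem
  set a := ∫ ω, A ω ^ 2 ∂μ
  set y := ∫ ω, h ω ^ 2 ∂μ
  have ha : 0 ≤ a := integral_nonneg fun ω => sq_nonneg _
  have hy : 0 ≤ y := integral_nonneg fun ω => sq_nonneg _
  have hfirst : (∫ ω, (A ω * |ξ ω|) ^ p ∂μ) ^ (1 / p) ≤ σ * √a := by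
    have hle : ∫ ω, (A ω * |ξ ω|) ^ p ∂μ ≤ (σ * √a) ^ p :=
      calc ∫ ω, (A ω * |ξ ω|) ^ p ∂μ ≤ σ ^ p * ∫ ω, A ω ^ p ∂μ :=
            integral_mul_abs_rpow_le_of_condExp_le hm hp0.le hA hA0 hA1 hξ hs
        _ ≤ σ ^ p * a ^ (p / 2) := by
            gcongr
            exact integral_rpow_le_integral_sq_rpow hAm₀ hA0 hA1 hp0.le hp2
        _ = (σ * √a) ^ p := by
            rw [Real.mul_rpow hσ (Real.sqrt_nonneg a), Real.sqrt_eq_rpow, ← Real.rpow_mul ha]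
            congr 2
            ring
    calc _ ≤ ((σ * √a) ^ p) ^ (1 / p) := by
          refine Real.rpow_le_rpow (integral_nonneg fun ω => ?_) hle (by positivity)
          exact Real.rpow_nonneg (mul_nonneg (hA0 ω) (abs_nonneg _)) _
      _ = σ * √a := by
          rw [one_div, Real.rpow_rpow_inv (by positivity) hp0.ne']
  have hsecond : (∫ ω, h ω ^ q ∂μ) ^ (1 / q) ≤ y ^ (1 / q) := by
    refine Real.rpow_le_rpow (integral_nonneg fun ω => Real.rpow_nonneg (hh0 ω) _) ?_ (by positivity)
    refine integral_mono (integrable_of_abs_le_one (hh.pow_const q) fun ω => ?_)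
      (integrable_of_abs_le_one (hh.pow_const 2) fun ω => ?_) fun ω => ?_
    · rw [abs_of_nonneg (Real.rpow_nonneg (hh0 ω) _)]
      exact Real.rpow_le_one (hh0 ω) (hh1 ω) hq0.le
    · rw [abs_of_nonneg (sq_nonneg _)]
      exact pow_le_one₀ (hh0 ω) (hh1 ω)
    · rw [← Real.rpow_two]
      exact Real.rpow_le_rpow_of_exponent_ge' (hh0 ω) (hh1 ω) (by norm_num) hq2
  have hysq : y ^ (2 / q) = (y ^ (1 / q)) ^ 2 := by
    rw [← Real.rpow_natCast, ← Real.rpow_mul hy]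
    congr 1
    push_cast
    ring
  calc _ ≤ σ * √a * y ^ (1 / q) :=
        holder.trans (mul_le_mul hfirst hsecond (Real.rpow_nonneg
          (integral_nonneg fun ω => Real.rpow_nonneg (hh0 ω) _) _) (by positivity))
    _ ≤ c / 4 * √a ^ 2 + σ ^ 2 / c * (y ^ (1 / q)) ^ 2 := by
        have hsq : 0 ≤ c * (√a / 2 - σ / c * y ^ (1 / q)) ^ 2 := by positivity
        have hexp : c * (√a / 2 - σ / c * y ^ (1 / q)) ^ 2 =
            c / 4 * √a ^ 2 + σ ^ 2 / c * (y ^ (1 / q)) ^ 2 - σ * √a * y ^ (1 / q) := by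
          field_simp
          ring
        linarith
    _ = _ := by rw [Real.sq_sqrt ha, hysq]

lemma abs_div_add_sqrt_le_one {a w lam : ℝ} (hlam : 0 < lam) (h : a ^ 2 ≤ w) :
    |a| / (lam + √w) ≤ 1 := by
  rw [div_le_one (by positivity)]
  linarith [Real.abs_le_sqrt h]

lemma sq_div_add_sqrt_le {a v lam : ℝ} (hlam : 0 < lam) (hv : 0 ≤ v) :
    (|a| / (lam + √v)) ^ 2 ≤ a ^ 2 / (lam ^ 2 + v) := by
  rw [div_pow, sq_abs]
  refine div_le_div_of_nonneg_left (sq_nonneg a) (by positivity) ?_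
  nlinarith [Real.sq_sqrt hv, Real.sqrt_nonneg v]

lemma abs_sqrt_add_sq_sub_sqrt_add_sq_le {V G c g : ℝ} (hV : 0 ≤ V) (hc : 0 < c) :
    |√(V + g ^ 2) - √(V + G ^ 2 + c ^ 2)| ≤ |g - G| + c := by
  set r := √(V + g ^ 2)
  set s := √(V + G ^ 2 + c ^ 2)
  have hr2 : r ^ 2 = V + g ^ 2 := Real.sq_sqrt (by positivity)
  have hs2 : s ^ 2 = V + G ^ 2 + c ^ 2 := Real.sq_sqrt (by positivity)
  have hr : |g| ≤ r := Real.abs_le_sqrt (by linarith)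
  have hs : |G| ≤ s := Real.abs_le_sqrt (by nlinarith)
  have hcs : c ≤ s := Real.le_sqrt_of_sq_le (by nlinarith)
  have hr0 : 0 ≤ r := Real.sqrt_nonneg _
  have hpos : 0 < r + s := by linarith
  refine le_of_mul_le_mul_right ?_ hpos
  calc |r - s| * (r + s) = |(g - G) * (g + G) - c ^ 2| := by
        rw [show (g - G) * (g + G) - c ^ 2 = (r - s) * (r + s) by linear_combination hs2 - hr2,
          abs_mul, abs_of_pos hpos]
    _ ≤ |g - G| * |g + G| + c ^ 2 := by
        have htri := abs_sub ((g - G) * (g + G)) (c ^ 2)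
        rwa [abs_mul, abs_of_nonneg (sq_nonneg c)] at htri
    _ ≤ |g - G| * (r + s) + c * (r + s) := by
        have := abs_add_le g G
        gcongr
        · linarith
        · nlinarith
    _ = (|g - G| + c) * (r + s) := by ring

lemma mul_div_sub_mul_div_le {V G c g lam : ℝ} (hlam : 0 < lam) (hV : 0 ≤ V) (hc : 0 < c) :
    G * g / (lam + √(V + G ^ 2 + c ^ 2)) - G * g / (lam + √(V + g ^ 2)) ≤
      |G| / (lam + √(V + G ^ 2 + c ^ 2)) * |g - G| * (|g| / (lam + √(V + g ^ 2))) +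
        1 / 4 * (G ^ 2 / (lam + √(V + G ^ 2 + c ^ 2))) + c * (g ^ 2 / (lam ^ 2 + (V + g ^ 2))) := by
  have hY := sq_div_add_sqrt_le (a := g) hlam (v := V + g ^ 2) (by positivity)
  have hdiff := abs_sqrt_add_sq_sub_sqrt_add_sq_le (G := G) (g := g) hV hc
  have hcs : c ≤ √(V + G ^ 2 + c ^ 2) := Real.le_sqrt_of_sq_le (by nlinarith)
  set r := √(V + g ^ 2)
  set s := √(V + G ^ 2 + c ^ 2)
  have hr0 : 0 ≤ r := Real.sqrt_nonneg _
  have hR : 0 < lam + r := by linarith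
  have hS : 0 < lam + s := by linarith
  set A := |G| / (lam + s) with hA
  set h := |g| / (lam + r) with hh
  have hAh : 0 ≤ A * h := by positivity
  have hG2 : G ^ 2 / (lam + s) = A ^ 2 * (lam + s) := by
    rw [hA, div_pow, sq_abs]
    field_simp
  have hstep : G * g / (lam + s) - G * g / (lam + r) ≤ A * h * (|g - G| + c) :=
    calc G * g / (lam + s) - G * g / (lam + r)
        = G * g / ((lam + s) * (lam + r)) * (r - s) := by field_simp; ring
      _ ≤ |G * g / ((lam + s) * (lam + r)) * (r - s)| := le_abs_self _
      _ = A * h * |r - s| := by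
          rw [abs_mul, abs_div, abs_mul, abs_mul, abs_of_pos hR, abs_of_pos hS, hA, hh]
          field_simp
      _ ≤ A * h * (|g - G| + c) := by gcongr
  rw [hG2]
  nlinarith [mul_nonneg hc.le (sq_nonneg (A / 2 - h)), mul_le_mul_of_nonneg_left hY hc.le,
    mul_le_mul_of_nonneg_left (show c ≤ lam + s by linarith) (sq_nonneg A)]

/-- The one-coordinate version of the progress inequality: `G` is the conditional mean of the
stochastic gradient `g`, and `V` is the accumulator of the previous steps. -/
lemma half_integral_sq_div_proxy_le (hm : m ≤ m₀) {G V g : Ω → ℝ} {lam p σ c : ℝ} (hlam : 0 < lam)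
    (hp1 : 1 < p) (hp2 : p ≤ 2) (hσ : 0 ≤ σ) (hc : 0 < c)
    (hG : Measurable[m] G) (hV : Measurable[m] V) (hV0 : ∀ ω, 0 ≤ V ω)
    (hg : Measurable g) (hgint : Integrable g μ) (hmean : μ[g | m] =ᵐ[μ] G)
    (hξ : Integrable (fun ω => |g ω - G ω| ^ p) μ)
    (hs : ∀ᵐ ω ∂μ, (μ[fun ω => |g ω - G ω| ^ p | m]) ω ≤ σ ^ p) :
    1 / 2 * ∫ ω, G ω ^ 2 / (lam + √(V ω + G ω ^ 2 + c ^ 2)) ∂μ ≤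
      ∫ ω, G ω * g ω / (lam + √(V ω + g ω ^ 2)) ∂μ +
      σ ^ 2 / c * (∫ ω, g ω ^ 2 / (lam ^ 2 + (V ω + g ω ^ 2)) ∂μ) ^ (2 / (p / (p - 1))) +
      c * ∫ ω, g ω ^ 2 / (lam ^ 2 + (V ω + g ω ^ 2)) ∂μ := by
  have hGm₀ : Measurable G := hG.mono hm le_rfl
  have hVm₀ : Measurable V := hV.mono hm le_rfl
  have hGint : Integrable G μ := integrable_condExp.congr hmean
  set A : Ω → ℝ := fun ω => |G ω| / (lam + √(V ω + G ω ^ 2 + c ^ 2)) with hA_def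
  set B : Ω → ℝ := fun ω => G ω / (lam + √(V ω + G ω ^ 2 + c ^ 2)) with hB_def
  set h : Ω → ℝ := fun ω => |g ω| / (lam + √(V ω + g ω ^ 2)) with hh_def
  set Y : Ω → ℝ := fun ω => g ω ^ 2 / (lam ^ 2 + (V ω + g ω ^ 2)) with hY_def
  have hBm : Measurable[m] B := hG.div (by fun_prop)
  have hAB : ∀ ω, A ω = |B ω| := fun ω => by
    simp only [hA_def, hB_def, abs_div]
    rw [abs_of_pos (a := lam + _) (by positivity)]
  have hAm : Measurable[m] A := by
    rw [funext hAB]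
    fun_prop
  have hA0 : ∀ ω, 0 ≤ A ω := fun ω => by positivity
  have hA1 : ∀ ω, A ω ≤ 1 := fun ω =>
    abs_div_add_sqrt_le_one hlam (by nlinarith [hV0 ω, sq_nonneg c])
  have hB1 : ∀ ω, |B ω| ≤ 1 := fun ω => hAB ω ▸ hA1 ω
  have hBm₀ : Measurable B := hBm.mono hm le_rfl
  have hAm₀ : Measurable A := hAm.mono hm le_rfl
  have hhm : Measurable h := by fun_prop
  have hh0 : ∀ ω, 0 ≤ h ω := fun ω => by positivity
  have hh1 : ∀ ω, h ω ≤ 1 := fun ω => abs_div_add_sqrt_le_one hlam (by linarith [hV0 ω])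
  have hYm : Measurable Y := by fun_prop
  have hv0 : ∀ ω, 0 ≤ V ω + g ω ^ 2 := fun ω => add_nonneg (hV0 ω) (sq_nonneg _)
  have hY0 : ∀ ω, 0 ≤ Y ω := fun ω => by have := hv0 ω; positivity
  have hYint : Integrable Y μ := integrable_of_abs_le_one hYm fun ω => by
    rw [abs_of_nonneg (hY0 ω)]
    exact div_le_one_of_le₀ (by nlinarith [hV0 ω]) (by have := hv0 ω; positivity)
  have hhY : ∀ ω, h ω ^ 2 ≤ Y ω := fun ω => sq_div_add_sqrt_le hlam (hv0 ω)
  have hbdd : ∀ {a : Ω → ℝ}, Measurable a → (∀ ω, 0 ≤ a ω) → (∀ ω, a ω ≤ 1) →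
      Integrable (fun ω => a ω ^ 2) μ := fun ha ha0 ha1 =>
    integrable_of_abs_le_one (ha.pow_const 2) fun ω => by
      rw [abs_of_nonneg (sq_nonneg _)]
      exact pow_le_one₀ (ha0 ω) (ha1 ω)
  have hBG : ∀ ω, G ω ^ 2 / (lam + √(V ω + G ω ^ 2 + c ^ 2)) = B ω * G ω := fun ω => by
    simp only [hB_def]
    ring
  have hBGint : Integrable (fun ω => B ω * G ω) μ :=
    hGint.bdd_mul (c := 1) hBm₀.aestronglyMeasurable (.of_forall hB1)
  have hBgint : Integrable (fun ω => B ω * g ω) μ :=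
    hgint.bdd_mul (c := 1) hBm₀.aestronglyMeasurable (.of_forall hB1)
  have hDint : Integrable (fun ω => G ω * g ω / (lam + √(V ω + g ω ^ 2))) μ := by
    refine hGint.mono (Measurable.aestronglyMeasurable (by fun_prop)) (.of_forall fun ω => ?_)
    rw [mul_div_assoc, norm_mul, norm_div, Real.norm_of_nonneg (r := lam + _) (by positivity)]
    exact mul_le_of_le_one_right (norm_nonneg _) (hh1 ω)
  have hNint : Integrable (fun ω => A ω * |g ω - G ω| * h ω) μ := by
    refine (hgint.sub hGint).mono (by fun_prop) (.of_forall fun ω => ?_)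
    rw [Real.norm_of_nonneg (mul_nonneg (mul_nonneg (hA0 ω) (abs_nonneg _)) (hh0 ω))]
    calc A ω * |g ω - G ω| * h ω ≤ A ω * |g ω - G ω| :=
          mul_le_of_le_one_right (mul_nonneg (hA0 ω) (abs_nonneg _)) (hh1 ω)
      _ ≤ |g ω - G ω| := mul_le_of_le_one_left (abs_nonneg _) (hA1 ω)
  have hmeanB : ∫ ω, B ω * g ω ∂μ = ∫ ω, B ω * G ω ∂μ := by
    rw [integral_mul_condExp_of_abs_le_one hm hBm hB1 hgint]
    refine integral_congr_ae ?_
    filter_upwards [hmean] with ω hω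
    rw [hω]
  have hpoint : ∫ ω, B ω * g ω ∂μ ≤ ∫ ω, (G ω * g ω / (lam + √(V ω + g ω ^ 2)) +
      A ω * |g ω - G ω| * h ω + 1 / 4 * (B ω * G ω) + c * Y ω) ∂μ := by
    refine integral_mono hBgint
      (((hDint.add hNint).add (hBGint.const_mul _)).add (hYint.const_mul c)) fun ω => ?_
    have key := mul_div_sub_mul_div_le (G := G ω) (g := g ω) hlam (hV0 ω) hc
    rw [hBG ω] at key
    have hBg : B ω * g ω = G ω * g ω / (lam + √(V ω + G ω ^ 2 + c ^ 2)) := by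
      simp only [hB_def]
      ring
    simp only [hBg]
    linarith
  rw [integral_add (by fun_prop) (by fun_prop), integral_add (by fun_prop) (by fun_prop),
    integral_add hDint hNint,
    integral_const_mul, integral_const_mul, hmeanB] at hpoint
  have hnoise := integral_mul_noise_mul_le hm hp1 hp2 hσ hc hAm hA0 hA1 hhm hh0 hh1
    (hg.sub hGm₀) hξ hs
  have hA2 : c * ∫ ω, A ω ^ 2 ∂μ ≤ ∫ ω, B ω * G ω ∂μ := by
    rw [← integral_const_mul]
    refine integral_mono ((hbdd hAm₀ hA0 hA1).const_mul c) hBGint fun ω => ?_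
    have hcs : c ≤ √(V ω + G ω ^ 2 + c ^ 2) :=
      Real.le_sqrt_of_sq_le (by nlinarith [hV0 ω, sq_nonneg (G ω)])
    have hBG' : B ω * G ω = A ω ^ 2 * (lam + √(V ω + G ω ^ 2 + c ^ 2)) := by
      simp only [hA_def, hB_def, div_pow, sq_abs]
      have : 0 < lam + √(V ω + G ω ^ 2 + c ^ 2) := by positivity
      field_simp
    simp only [hBG']
    nlinarith [mul_le_mul_of_nonneg_left (show c ≤ lam + √(V ω + G ω ^ 2 + c ^ 2) by linarith)
      (sq_nonneg (A ω))]
  have hhle : (∫ ω, h ω ^ 2 ∂μ) ^ (2 / (p / (p - 1))) ≤ (∫ ω, Y ω ∂μ) ^ (2 / (p / (p - 1))) := by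
    have : 0 < p - 1 := by linarith
    exact Real.rpow_le_rpow (integral_nonneg fun ω => sq_nonneg _)
      (integral_mono (hbdd hhm hh0 hh1) hYint hhY) (by positivity)
  have hmul := mul_le_mul_of_nonneg_left hhle (show 0 ≤ σ ^ 2 / c by positivity)
  simp only [Pi.sub_apply] at hnoise
  simp only [hBG]
  linarith

end Helpers

lemma natFilt_le_s6 {Ω : Type} [MeasurableSpace Ω] {d : ℕ} {g : ℕ → Ω → EuclideanSpace ℝ (Fin d)}
    (hg : ∀ t, Measurable (g t)) (t : ℕ) : natFilt g t ≤ ‹MeasurableSpace Ω› :=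
  iSup₂_le fun s _ => (hg s).comap_le

lemma measurable_adaV {Ω : Type} [MeasurableSpace Ω] {d : ℕ}
    (g : ℕ → Ω → EuclideanSpace ℝ (Fin d)) (t : ℕ) (i : Fin d) :
    Measurable[natFilt g t] fun ω => adaV g t ω i := by
  refine Finset.measurable_sum _ fun s hs => ?_
  have hgs : Measurable[natFilt g t] (g s) :=
    (comap_measurable (g s)).mono (le_iSup₂_of_le s hs le_rfl) le_rfl
  have hcoord : Measurable fun y : EuclideanSpace ℝ (Fin d) => y i := by fun_prop
  exact (hcoord.comp hgs).pow_const 2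

lemma adaV_nonneg {Ω : Type} {d : ℕ} (g : ℕ → Ω → EuclideanSpace ℝ (Fin d))
    (t : ℕ) (ω : Ω) (i : Fin d) : 0 ≤ adaV g t ω i :=
  Finset.sum_nonneg fun _ _ => sq_nonneg _

lemma adaV_eq_pred_add_sq {Ω : Type} {d : ℕ} (g : ℕ → Ω → EuclideanSpace ℝ (Fin d))
    {t : ℕ} (ht : 1 ≤ t) (ω : Ω) (i : Fin d) :
    adaV g t ω i = adaV g (t - 1) ω i + g t ω i ^ 2 := by
  obtain ⟨n, rfl⟩ := Nat.exists_eq_add_of_le' ht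
  exact Finset.sum_Icc_succ_top (by omega) _

/-- the per-iteration progress inequality for AdaGrad with the
generalized proxy stepsize `w_{t,i} = v_{t−1,i} + (∇_i f(x_t))² + c_i²`.
Under (A2)–(A4), for any `c` with positive coordinates and any `t ≥ 1`,
`(γ/2)·E[∑_i (∇_i f(x_t))²/(λ + √w_{t,i})]
  ≤ E[f(x_t) − f(x_{t+1})]
    + γ ∑_i (σ_i²/c_i)·(E[g_{t,i}²/(λ² + v_{t,i})])^{2/p̄}
    + γ ∑_i (c_i + γ L_i/2)·E[g_{t,i}²/(λ² + v_{t,i})]`, where `p̄ = p/(p−1)`. -/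
theorem adagrad_core_inequality
    (d : ℕ) (Ω : Type) [MeasurableSpace Ω] (μ : Measure Ω) [IsProbabilityMeasure μ]
    (f : EuclideanSpace ℝ (Fin d) → ℝ)
    (gradf : EuclideanSpace ℝ (Fin d) → EuclideanSpace ℝ (Fin d))
    (g x : ℕ → Ω → EuclideanSpace ℝ (Fin d)) (x₁ : EuclideanSpace ℝ (Fin d))
    (γ lam p : ℝ) (L σ : Fin d → ℝ)
    (hγ : 0 < γ) (hlam : 0 < lam)
    (hgrad : ∀ y, HasGradientAt f (gradf y) y)
    (hL : ∀ i, 0 < L i)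
    (hsmooth : ∀ u v : EuclideanSpace ℝ (Fin d),
      |f u - f v - ∑ i, gradf v i * (u i - v i)| ≤ 1 / 2 * ∑ i, L i * (u i - v i) ^ 2)
    (hgmeas : ∀ t, Measurable (g t))
    (hgint : ∀ t, Integrable (g t) μ)
    (hfint : ∀ t, Integrable (fun ω => f (x t ω)) μ)
    (hx1 : ∀ ω, x 1 ω = x₁)
    (hxupd : ∀ t, 1 ≤ t → ∀ ω (i : Fin d),
      x (t + 1) ω i = x t ω i - γ * g t ω i / (lam + Real.sqrt (adaV g t ω i)))
    (hunbiased : ∀ t, 1 ≤ t → ∀ i : Fin d,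
      μ[(fun ω => g t ω i) | natFilt g (t - 1)] =ᵐ[μ] fun ω => gradf (x t ω) i)
    (hp1 : 1 < p) (hp2 : p ≤ 2) (hσ : ∀ i, 0 ≤ σ i)
    (hnoise : ∀ t, 1 ≤ t → ∀ i : Fin d,
      Integrable (fun ω => |g t ω i - gradf (x t ω) i| ^ p) μ ∧
      ∀ᵐ ω ∂μ,
        (μ[(fun ω' => |g t ω' i - gradf (x t ω') i| ^ p) | natFilt g (t - 1)]) ω ≤ σ i ^ p)
    (c : Fin d → ℝ) (hc : ∀ i, 0 < c i) (t : ℕ) (ht : 1 ≤ t) :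
    γ / 2 * ∫ ω, ∑ i, (gradf (x t ω) i) ^ 2 /
        (lam + Real.sqrt (adaV g (t - 1) ω i + (gradf (x t ω) i) ^ 2 + c i ^ 2)) ∂μ ≤
      (∫ ω, (f (x t ω) - f (x (t + 1) ω)) ∂μ) +
      γ * ∑ i, σ i ^ 2 / c i *
        (∫ ω, (g t ω i) ^ 2 / (lam ^ 2 + adaV g t ω i) ∂μ) ^ (2 / (p / (p - 1))) +
      γ * ∑ i, (c i + γ * L i / 2) *
        ∫ ω, (g t ω i) ^ 2 / (lam ^ 2 + adaV g t ω i) ∂μ := by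
  have hm : natFilt g (t - 1) ≤ ‹MeasurableSpace Ω› := natFilt_le_s6 hgmeas (t - 1)
  have hgi : ∀ i, Integrable (fun ω => g t ω i) μ := fun i => (hgint t).eval_piLp i
  have hgim : ∀ i, Measurable fun ω => g t ω i := fun i => by
    have := hgmeas t
    fun_prop
  have hVm : ∀ i, Measurable fun ω => adaV g t ω i := fun i =>
    (measurable_adaV g t i).mono (natFilt_le_s6 hgmeas t) le_rfl
  have hGint : ∀ i, Integrable (fun ω => gradf (x t ω) i) μ := fun i =>
    integrable_condExp.congr (hunbiased t ht i)
  have hYint : ∀ i, Integrable (fun ω => g t ω i ^ 2 / (lam ^ 2 + adaV g t ω i)) μ := fun i => by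
    refine integrable_of_abs_le_one (((hgim i).pow_const 2).div ((hVm i).const_add _)) fun ω => ?_
    have hV0 := adaV_nonneg g (t - 1) ω i
    have hv := adaV_eq_pred_add_sq g ht ω i
    have hv0 := adaV_nonneg g t ω i
    rw [abs_of_nonneg (by positivity)]
    exact div_le_one_of_le₀ (by nlinarith) (by positivity)
  have hDint : ∀ i, Integrable
      (fun ω => gradf (x t ω) i * g t ω i / (lam + √(adaV g t ω i))) μ := fun i => by
    have hquot : Measurable fun ω => g t ω i / (lam + √(adaV g t ω i)) :=
      (hgim i).div ((hVm i).sqrt.const_add _)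
    simp_rw [mul_div_assoc]
    refine (hGint i).mul_bdd (c := 1) hquot.aestronglyMeasurable (.of_forall fun ω => ?_)
    rw [norm_div, Real.norm_of_nonneg (r := lam + _) (by positivity), Real.norm_eq_abs]
    refine abs_div_add_sqrt_le_one hlam ?_
    linarith [adaV_nonneg g (t - 1) ω i, adaV_eq_pred_add_sq g ht ω i]
  have hcoord : ∀ i, 1 / 2 * ∫ ω, gradf (x t ω) i ^ 2 /
        (lam + √(adaV g (t - 1) ω i + gradf (x t ω) i ^ 2 + c i ^ 2)) ∂μ ≤
      ∫ ω, gradf (x t ω) i * g t ω i / (lam + √(adaV g t ω i)) ∂μ +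
      σ i ^ 2 / c i *
        (∫ ω, g t ω i ^ 2 / (lam ^ 2 + adaV g t ω i) ∂μ) ^ (2 / (p / (p - 1))) +
      c i * ∫ ω, g t ω i ^ 2 / (lam ^ 2 + adaV g t ω i) ∂μ := fun i => by
    set G := μ[(fun ω => g t ω i) | natFilt g (t - 1)] with hG
    have hGeq : G =ᵐ[μ] fun ω => gradf (x t ω) i := hunbiased t ht i
    have hnoise_eq : (fun ω => |g t ω i - gradf (x t ω) i| ^ p) =ᵐ[μ]
        fun ω => |g t ω i - G ω| ^ p := by
      filter_upwards [hGeq] with ω hω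
      rw [hω]
    have hcond : ∀ᵐ ω ∂μ, (μ[fun ω => |g t ω i - G ω| ^ p | natFilt g (t - 1)]) ω ≤ σ i ^ p := by
      filter_upwards [(hnoise t ht i).2,
        condExp_congr_ae (m := natFilt g (t - 1)) hnoise_eq] with ω h1 h2
      rwa [← h2]
    have key := half_integral_sq_div_proxy_le hm hlam hp1 hp2 (hσ i) (hc i)
      stronglyMeasurable_condExp.measurable (measurable_adaV g (t - 1) i)
      (fun ω => adaV_nonneg g (t - 1) ω i) (hgim i) (hgi i) (G := G) (by rw [hG])
      ((hnoise t ht i).1.congr hnoise_eq) hcond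
    simp only [← adaV_eq_pred_add_sq g ht] at key
    have hcongr : ∀ F : Ω → ℝ → ℝ, ∫ ω, F ω (G ω) ∂μ = ∫ ω, F ω (gradf (x t ω) i) ∂μ :=
      fun F => integral_congr_ae <| by
        filter_upwards [hGeq] with ω hω
        rw [hω]
    rwa [hcongr fun ω y => y ^ 2 / (lam + √(adaV g (t - 1) ω i + y ^ 2 + c i ^ 2)),
      hcongr fun ω y => y * g t ω i / (lam + √(adaV g t ω i))] at key
  have hLHSint : ∀ i, Integrable (fun ω => gradf (x t ω) i ^ 2 /
      (lam + √(adaV g (t - 1) ω i + gradf (x t ω) i ^ 2 + c i ^ 2))) μ := fun i => by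
    have hVm' : Measurable fun ω => adaV g (t - 1) ω i := (measurable_adaV g (t - 1) i).mono hm le_rfl
    have hGm := (hGint i).aestronglyMeasurable.aemeasurable
    refine (hGint i).mono (AEMeasurable.aestronglyMeasurable (by fun_prop)) (.of_forall fun ω => ?_)
    have hle : |gradf (x t ω) i| /
        (lam + √(adaV g (t - 1) ω i + gradf (x t ω) i ^ 2 + c i ^ 2)) ≤ 1 :=
      abs_div_add_sqrt_le_one hlam (by nlinarith [adaV_nonneg g (t - 1) ω i, sq_nonneg (c i)])
    rw [← Real.norm_eq_abs] at hle
    rw [sq (gradf (x t ω) i)] at hle ⊢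
    rw [mul_div_assoc, norm_mul, norm_div, Real.norm_of_nonneg (r := lam + _) (by positivity)]
    exact mul_le_of_le_one_right (norm_nonneg _) hle
  have hdescent : ∀ ω, γ * ∑ i, gradf (x t ω) i * g t ω i / (lam + √(adaV g t ω i)) ≤
      (f (x t ω) - f (x (t + 1) ω)) +
        γ * ∑ i, γ * L i / 2 * (g t ω i ^ 2 / (lam ^ 2 + adaV g t ω i)) := fun ω => by
    have hs := (abs_le.mp (hsmooth (x (t + 1) ω) (x t ω))).2
    have hstep : ∀ i, x (t + 1) ω i - x t ω i = -(γ * (g t ω i / (lam + √(adaV g t ω i)))) :=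
      fun i => by
        rw [hxupd t ht ω i]
        ring
    simp only [hstep] at hs
    have hlin : ∑ i, gradf (x t ω) i * -(γ * (g t ω i / (lam + √(adaV g t ω i)))) =
        -(γ * ∑ i, gradf (x t ω) i * g t ω i / (lam + √(adaV g t ω i))) := by
      rw [Finset.mul_sum, ← Finset.sum_neg_distrib]
      exact Finset.sum_congr rfl fun i _ => by ring
    have hquad : 1 / 2 * ∑ i, L i * (-(γ * (g t ω i / (lam + √(adaV g t ω i))))) ^ 2 ≤
        γ * ∑ i, γ * L i / 2 * (g t ω i ^ 2 / (lam ^ 2 + adaV g t ω i)) := by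
      rw [Finset.mul_sum, Finset.mul_sum]
      refine Finset.sum_le_sum fun i _ => ?_
      have hY := sq_div_add_sqrt_le (a := g t ω i) hlam (adaV_nonneg g t ω i)
      rw [div_pow, sq_abs] at hY
      have hLi := hL i
      calc _ = γ ^ 2 * L i / 2 * (g t ω i ^ 2 / (lam + √(adaV g t ω i)) ^ 2) := by
            rw [← div_pow]
            ring
        _ ≤ γ ^ 2 * L i / 2 * (g t ω i ^ 2 / (lam ^ 2 + adaV g t ω i)) := by gcongr
        _ = _ := by ring
    linarith
  have hfdiff : Integrable (fun ω => f (x t ω) - f (x (t + 1) ω)) μ :=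
    (hfint t).sub (hfint (t + 1))
  have hQint : Integrable
      (fun ω => γ * ∑ i, γ * L i / 2 * (g t ω i ^ 2 / (lam ^ 2 + adaV g t ω i))) μ :=
    (integrable_finsetSum _ fun i _ => (hYint i).const_mul _).const_mul γ
  have hdescent_int := integral_mono
    ((integrable_finsetSum _ fun i _ => hDint i).const_mul γ) (hfdiff.add hQint) hdescent
  simp only [Pi.add_apply] at hdescent_int
  rw [integral_add hfdiff hQint, integral_const_mul, integral_const_mul,
    integral_finsetSum _ fun i _ => hDint i,
    integral_finsetSum _ fun i _ => (hYint i).const_mul _] at hdescent_int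
  simp only [integral_const_mul] at hdescent_int
  rw [integral_finsetSum _ fun i _ => hLHSint i]
  have hsum := mul_le_mul_of_nonneg_left (Finset.sum_le_sum fun i (_ : i ∈ univ) => hcoord i) hγ.le
  simp only [Finset.sum_add_distrib, ← Finset.mul_sum, add_mul] at hsum ⊢
  linarith
end

section
/- Given Δ > 0, L > 0, 0 < ε ≤ √(2ΔL), x₁ ∈ ℝ, and a nonnegative real sequence (δ_t)_{t≥1}, define T_* = inf{T ∈ ℕ : Δ − ε·∑_{t=1}^T δ_t + (L/4)·∑_{t=1}^T δ_t² < ε²/(2L)} and assume T_* < ∞. Define y_t = x₁ + ∑_{s=1}^{t−1} δ_s for t ∈ {1,…,T_*}. Then there exists a differentiable function f : ℝ → ℝ such that: f(x₁) − inf_{x∈ℝ} f(x) ≤ Δ; f' is L-Lipschitz; and f'(y_t) = −ε for every t ∈ {1,…,T_*}. -/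
/-- Comparison: if `f' ≥ -ε + L (x - a)` on `[a, b]`, then `f` lies above the quadratic model. -/
lemma quadratic_lower_bound_of_deriv_ge_left {f f' : ℝ → ℝ} {a b ε L : ℝ}
    (hf : ∀ x, HasDerivAt f (f' x) x) (hab : a ≤ b)
    (h : ∀ x, a ≤ x → x ≤ b → -ε + L * (x - a) ≤ f' x) :
    f a - ε * (b - a) + L / 2 * (b - a) ^ 2 ≤ f b := by
  have hd : ∀ x, HasDerivAt (fun x => f x + ε * x - L / 2 * (x - a) ^ 2)
      (f' x + ε - L * (x - a)) x := fun x => by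
    have := ((hf x).add ((hasDerivAt_id x).const_mul ε)).sub
      ((((hasDerivAt_id x).sub_const a).pow 2).const_mul (L / 2))
    exact this.congr_deriv (by simp; ring)
  have hm : MonotoneOn (fun x => f x + ε * x - L / 2 * (x - a) ^ 2) (Set.Icc a b) :=
    monotoneOn_of_hasDerivWithinAt_nonneg (convex_Icc a b)
      (fun x _ => (hd x).continuousAt.continuousWithinAt)
      (fun x _ => (hd x).hasDerivWithinAt) fun x hx => by
        rw [interior_Icc] at hx
        linarith [h x hx.1.le hx.2.le]
  have := hm (Set.left_mem_Icc.2 hab) (Set.right_mem_Icc.2 hab) hab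
  simp only at this
  linarith

/-- Comparison: if `f' ≥ -ε + L (b - x)` on `[c, x]`, then `f` lies above the concave model. -/
lemma quadratic_lower_bound_of_deriv_ge_right {f f' : ℝ → ℝ} {b c x ε L : ℝ}
    (hf : ∀ x, HasDerivAt f (f' x) x) (hcx : c ≤ x)
    (h : ∀ z, c ≤ z → z ≤ x → -ε + L * (b - z) ≤ f' z) :
    f c - ε * (x - c) + L / 2 * ((b - c) ^ 2 - (b - x) ^ 2) ≤ f x := by
  have := quadratic_lower_bound_of_deriv_ge_left (ε := ε - L * (b - c)) (L := -L) hf hcx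
    fun z hz hz' => by linarith [h z hz hz']
  linarith

/-- A quadratic with leading coefficient `L / 2` is bounded below by its vertex value. -/
lemma neg_sq_div_le_quadratic {L : ℝ} (hL : 0 < L) (ε u : ℝ) :
    -(ε ^ 2 / (2 * L)) ≤ -ε * u + L / 2 * u ^ 2 := by
  have : -ε * u + L / 2 * u ^ 2 + ε ^ 2 / (2 * L) = (L * u - ε) ^ 2 / (2 * L) := by
    field_simp
    ring
  have : 0 ≤ (L * u - ε) ^ 2 / (2 * L) := by positivity
  linarith

/-- Bounds for a function whose derivative dominates `-ε` plus a tent of slope `L` on `[a, b]`. -/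
lemma lower_bounds_of_deriv_ge_tent {f f' : ℝ → ℝ} {a b ε L m : ℝ} (hL : 0 < L)
    (hf : ∀ x, HasDerivAt f (f' x) x) (hab : a ≤ b)
    (h : ∀ x, a ≤ x → x ≤ b → -ε + L * min (x - a) (b - x) ≤ f' x)
    (ha : m + ε ^ 2 / (2 * L) ≤ f a) (hb : m ≤ f a - ε * (b - a) + L / 4 * (b - a) ^ 2) :
    f a - ε * (b - a) + L / 4 * (b - a) ^ 2 ≤ f b ∧ ∀ x, a ≤ x → x ≤ b → m ≤ f x := by
  have left : ∀ x, a ≤ x → x ≤ (a + b) / 2 →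
      f a - ε * (x - a) + L / 2 * (x - a) ^ 2 ≤ f x := fun x hx hx' =>
    quadratic_lower_bound_of_deriv_ge_left hf hx fun z hz hz' => by
      have := h z hz (by linarith)
      rwa [min_eq_left (by linarith)] at this
  have right : ∀ x, (a + b) / 2 ≤ x → x ≤ b →
      f ((a + b) / 2) - ε * (x - (a + b) / 2)
        + L / 2 * ((b - (a + b) / 2) ^ 2 - (b - x) ^ 2) ≤ f x := fun x hx hx' =>
    quadratic_lower_bound_of_deriv_ge_right hf hx fun z hz hz' => by
      have := h z (by linarith) (by linarith)
      rwa [min_eq_right (by linarith)] at this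
  have mid := left ((a + b) / 2) (by linarith) le_rfl
  refine ⟨by linarith [right b (by linarith) le_rfl], fun x hx hx' => ?_⟩
  rcases le_total x ((a + b) / 2) with hc | hc
  · linarith [left x hx hc, neg_sq_div_le_quadratic hL ε (x - a)]
  · have hr := right x hc hx'
    have hv := neg_sq_div_le_quadratic hL ε ((b - a) / 2)
    rcases hab.eq_or_lt with rfl | hlt
    · rw [le_antisymm hx' hx]
      linarith
    -- `x = (1 - s) (a + b) / 2 + s b`, and the model is concave on the right half.
    obtain ⟨s, hs⟩ : ∃ s, s = (2 * x - a - b) / (b - a) := ⟨_, rfl⟩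
    have hd : 0 < b - a := by linarith
    have hs0 : 0 ≤ s := hs ▸ div_nonneg (by linarith) hd.le
    have hs1 : s ≤ 1 := hs ▸ (div_le_one hd).2 (by linarith)
    have hxs : x = (a + b) / 2 + s * (b - a) / 2 := by
      rw [hs]
      field_simp
      ring
    have h0 : m ≤ f a - ε * ((b - a) / 2) + L / 2 * ((b - a) / 2) ^ 2 := by linarith
    have h1 := mul_le_mul_of_nonneg_left h0 (sub_nonneg.2 hs1)
    have h2 := mul_le_mul_of_nonneg_left hb hs0
    have h3 : 0 ≤ L / 8 * (b - a) ^ 2 * (s * (1 - s)) :=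
      mul_nonneg (by positivity) (mul_nonneg hs0 (sub_nonneg.2 hs1))
    rw [hxs] at hr ⊢
    linarith

/-- the hard-instance construction.  Given `Δ > 0`, `L > 0`,
`0 < ε ≤ √(2ΔL)`, `x₁ ∈ ℝ`, a nonnegative sequence `(δ_t)_{t ≥ 1}` and
`T_*` the least positive integer `T` with
`Δ − ε ∑_{t=1}^T δ_t + (L/4) ∑_{t=1}^T δ_t² < ε²/(2L)` (assumed to exist),
there is a differentiable `f : ℝ → ℝ` whose derivative is `L`-Lipschitz,
with `f(x₁) − inf f ≤ Δ` and `f'(y_t) = −ε` for all `t ∈ {1,…,T_*}`, where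
`y_t = x₁ + ∑_{s=1}^{t−1} δ_s`. -/
theorem adagrad_lb_construction (Δ L ε x₁ : ℝ) (δ : ℕ → ℝ)
    (hΔ : 0 < Δ) (hL : 0 < L) (hε : 0 < ε) (hε' : ε ≤ Real.sqrt (2 * Δ * L))
    (hδ : ∀ t, 0 ≤ δ t) (Tstar : ℕ)
    (hTstar : IsLeast {T : ℕ | 1 ≤ T ∧
      Δ - ε * ∑ t ∈ Finset.Icc 1 T, δ t + L / 4 * ∑ t ∈ Finset.Icc 1 T, (δ t) ^ 2
        < ε ^ 2 / (2 * L)} Tstar) :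
    ∃ f f' : ℝ → ℝ,
      (∀ x, HasDerivAt f (f' x) x) ∧
      LipschitzWith (Real.toNNReal L) f' ∧
      BddBelow (Set.range f) ∧
      f x₁ - (⨅ x : ℝ, f x) ≤ Δ ∧
      ∀ t ∈ Finset.Icc 1 Tstar, f' (x₁ + ∑ s ∈ Finset.Icc 1 (t - 1), δ s) = -ε := by
  obtain ⟨⟨hT, -⟩, hmin⟩ := hTstar
  set y : ℕ → ℝ := fun k => x₁ + ∑ s ∈ Finset.Icc 1 k, δ s with hy
  have hy0 : y 0 = x₁ := by simp [hy]
  have hys : ∀ k, y (k + 1) = y k + δ (k + 1) := fun k => by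
    simp only [hy, Finset.sum_Icc_succ_top (Nat.le_add_left 1 k)]
    ring
  have hmono : Monotone y := monotone_nat_of_le_succ fun k => by linarith [hys k, hδ (k + 1)]
  set A : ℕ → ℝ := fun k =>
    -ε * ∑ t ∈ Finset.Icc 1 k, δ t + L / 4 * ∑ t ∈ Finset.Icc 1 k, (δ t) ^ 2 with hA
  have hA0 : A 0 = 0 := by simp [hA]
  have hAs : ∀ k, A (k + 1) = A k - ε * δ (k + 1) + L / 4 * δ (k + 1) ^ 2 := fun k => by
    simp only [hA, Finset.sum_Icc_succ_top (Nat.le_add_left 1 k)]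
    ring
  have hAlow : ∀ k < Tstar, -Δ + ε ^ 2 / (2 * L) ≤ A k := fun k hk => by
    rcases Nat.eq_zero_or_pos k with rfl | hk0
    · have h2 : ε ^ 2 ≤ 2 * Δ * L := (Real.le_sqrt' hε).1 hε'
      have : ε ^ 2 / (2 * L) ≤ Δ := (div_le_iff₀ (by positivity)).2 (by linarith)
      linarith
    · by_contra! hlt
      refine absurd (hmin ⟨hk0, ?_⟩) (not_le.2 hk)
      simp only [hA] at hlt
      linarith
  set S : Set ℝ := Set.Iic x₁ ∪ Set.image y (Set.Iio Tstar) with hS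
  have hne : S.Nonempty := ⟨x₁, Or.inl Set.self_mem_Iic⟩
  set g : ℝ → ℝ := fun x => -ε + L * Metric.infDist x S with hg
  have hgS : ∀ x ∈ S, g x = -ε := fun x hx => by simp [hg, Metric.infDist_zero_of_mem hx]
  have hgcont : Continuous g :=
    continuous_const.add (continuous_const.mul (Metric.continuous_infDist_pt S))
  have hf : ∀ x, HasDerivAt (fun x => ∫ t in x₁..x, g t) (g x) x := fun x =>
    intervalIntegral.integral_hasDerivAt_right (hgcont.intervalIntegrable _ _)
      (hgcont.stronglyMeasurableAtFilter _ _) hgcont.continuousAt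
  obtain ⟨f, hf, hf1⟩ : ∃ f : ℝ → ℝ, (∀ x, HasDerivAt f (g x) x) ∧ f x₁ = 0 :=
    ⟨_, hf, intervalIntegral.integral_same⟩
  have hgtent : ∀ k, ∀ x, y k ≤ x → x ≤ y (k + 1) →
      -ε + L * min (x - y k) (y (k + 1) - x) ≤ g x := fun k x hx hx' => by
    have : min (x - y k) (y (k + 1) - x) ≤ Metric.infDist x S := by
      refine (Metric.le_infDist hne).2 fun z hz => ?_
      have hz' : z ≤ y k ∨ y (k + 1) ≤ z := by
        rcases hz with hz | ⟨j, -, rfl⟩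
        · exact Or.inl (hz.trans (hy0 ▸ hmono (Nat.zero_le k)))
        · exact (le_or_gt j k).imp (fun h => hmono h) fun h => hmono h
      rw [Real.dist_eq]
      rcases hz' with hz' | hz'
      · exact (min_le_left _ _).trans (by linarith [le_abs_self (x - z)])
      · exact (min_le_right _ _).trans (by linarith [neg_le_abs (x - z)])
    simp only [hg]
    gcongr
  have hnodes : ∀ k < Tstar, A k ≤ f (y k) ∧ ∀ x, x₁ ≤ x → x ≤ y k → -Δ ≤ f x := by
    intro k
    induction k with
    | zero =>
      intro _
      rw [hy0, hA0, hf1]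
      exact ⟨le_rfl, fun x hx hx' => by rw [le_antisymm hx' hx, hf1]; linarith⟩
    | succ k ih =>
      intro hk
      obtain ⟨ih1, ih2⟩ := ih (by omega)
      have hd : y (k + 1) - y k = δ (k + 1) := by linarith [hys k]
      have hpos : 0 ≤ ε ^ 2 / (2 * L) := by positivity
      have := lower_bounds_of_deriv_ge_tent (m := -Δ) hL hf (hmono k.le_succ) (hgtent k)
        (by linarith [hAlow k (by omega)])
        (by rw [hd]; linarith [hAlow (k + 1) hk, hAs k])
      rw [hd] at this
      refine ⟨by linarith [this.1, hAs k], fun x hx hx' => ?_⟩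
      rcases le_total x (y k) with h | h
      · exact ih2 x hx h
      · exact this.2 x h hx'
  have hlow : ∀ x, -Δ ≤ f x := by
    intro x
    rcases le_total x x₁ with hx | hx
    · have := quadratic_lower_bound_of_deriv_ge_left (f := fun z => -f z) (f' := fun z => -g z)
        (ε := -ε) (L := 0) (fun z => (hf z).neg) hx
        fun z _ hz => by simp [hgS z (Or.inl hz)]
      rw [hf1] at this
      nlinarith
    · obtain ⟨hN, hN'⟩ := hnodes (Tstar - 1) (by omega)
      rcases le_total x (y (Tstar - 1)) with h | h
      · exact hN' x hx h
      · have hq := quadratic_lower_bound_of_deriv_ge_left (ε := ε) (L := L) hf h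
          fun z hz _ => by
            have : z - y (Tstar - 1) ≤ Metric.infDist z S := by
              refine (Metric.le_infDist hne).2 fun w hw => ?_
              have hw' : w ≤ y (Tstar - 1) := by
                rcases hw with hw | ⟨j, hj, rfl⟩
                · exact hw.trans (hy0 ▸ hmono (Nat.zero_le _))
                · exact hmono (Nat.le_sub_one_of_lt hj)
              rw [Real.dist_eq]
              linarith [le_abs_self (z - w)]
            simp only [hg]
            gcongr
        linarith [hAlow (Tstar - 1) (by omega),
          neg_sq_div_le_quadratic hL ε (x - y (Tstar - 1))]
  refine ⟨f, g, hf, ?_, ⟨-Δ, ?_⟩, ?_, fun t ht => ?_⟩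
  · refine LipschitzWith.of_dist_le_mul fun x z => ?_
    have := (Metric.lipschitz_infDist_pt S).dist_le_mul x z
    rw [Real.coe_toNNReal L hL.le]
    simp only [hg, dist_add_left, NNReal.coe_one, one_mul] at this ⊢
    rw [Real.dist_eq, ← mul_sub, abs_mul, abs_of_pos hL, ← Real.dist_eq]
    gcongr
  · rintro _ ⟨x, rfl⟩
    exact hlow x
  · linarith [le_ciInf hlow]
  · rw [Finset.mem_Icc] at ht
    exact hgS _ (Or.inr ⟨t - 1, Set.mem_Iio.2 (by omega), rfl⟩)
end

section
/- Let c ∈ [3.92, 3.93] be the unique positive solution of 2c = (1+c)ln(1+c). Given real numbers A > 0 and B ≥ 1 satisfying ln(1 + 1/B) ≥ A and A√B ≤ (ln c)/√(2c), the first time the ratio ln(1 + T/B)/√T drops below A obeys inf{T ∈ ℕ : ln(1 + T/B)/√T < A} ≥ ⌈(4/A²)·ln²(2/(A√B))⌉. -/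
open Set

/-- The derivative of `x ↦ log (1 + x) / √x` has the sign of `2 * x - (1 + x) * log (1 + x)`. -/
lemma hasDerivAt_log_one_add_div_sqrt {x : ℝ} (hx : 0 < x) :
    HasDerivAt (fun y : ℝ => Real.log (1 + y) / √y)
      ((2 * x - (1 + x) * Real.log (1 + x)) / (2 * (1 + x) * x * √x)) x := by
  have hlog : HasDerivAt (fun y : ℝ => Real.log (1 + y)) (1 / (1 + x)) x :=
    ((hasDerivAt_id' x).const_add 1).log (by positivity)
  have hs : √x ≠ 0 := (Real.sqrt_pos.2 hx).ne'
  refine (hlog.fun_div (Real.hasDerivAt_sqrt hx.ne') hs).congr_deriv ?_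
  have hsq : √x ^ 2 = x := Real.sq_sqrt hx.le
  have h1x : 1 + x ≠ 0 := by positivity
  rw [hsq]
  field_simp
  rw [hsq]

lemma convexOn_one_add_mul_log_one_add_sub :
    ConvexOn ℝ (Ici 0) (fun x : ℝ => (1 + x) * Real.log (1 + x) - 2 * x) := by
  have h : ConvexOn ℝ (Ici 0) (fun x : ℝ => (1 + x) * Real.log (1 + x)) :=
    (Real.convexOn_mul_log.translate_right 1).subset
      (fun x (hx : 0 ≤ x) => show (0 : ℝ) ≤ 1 + x by positivity) (convex_Ici 0)
  refine h.sub ⟨convex_Ici 0, fun x _ y _ a b _ _ _ => ?_⟩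
  simp only [smul_eq_mul]
  linarith

lemma one_add_mul_log_one_add_le {c x : ℝ} (hc : 2 * c = (1 + c) * Real.log (1 + c))
    (hx : 0 ≤ x) (hxc : x ≤ c) : (1 + x) * Real.log (1 + x) ≤ 2 * x := by
  have h := convexOn_one_add_mul_log_one_add_sub.le_max_of_mem_Icc
    (self_mem_Ici (a := (0 : ℝ))) (show c ∈ Ici 0 from hx.trans hxc) ⟨hx, hxc⟩
  simp only [← hc, add_zero, Real.log_one, mul_zero, sub_self, max_self] at h
  linarith

lemma le_one_add_mul_log_one_add {c x : ℝ} (hc0 : 0 < c)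
    (hc : 2 * c = (1 + c) * Real.log (1 + c)) (hx : c < x) :
    2 * x ≤ (1 + x) * Real.log (1 + x) := by
  have h := convexOn_one_add_mul_log_one_add_sub.slope_mono_adjacent
    (self_mem_Ici (a := (0 : ℝ))) (show x ∈ Ici 0 from (hc0.trans hx).le) hc0 hx
  simp only [← hc, add_zero, Real.log_one, mul_zero, sub_self, zero_div, sub_zero] at h
  have := (le_div_iff₀ (sub_pos.2 hx)).1 h
  linarith

lemma monotoneOn_log_one_add_div_sqrt {c : ℝ} (hc : 2 * c = (1 + c) * Real.log (1 + c)) :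
    MonotoneOn (fun y : ℝ => Real.log (1 + y) / √y) (Ioc 0 c) := by
  refine monotoneOn_of_hasDerivWithinAt_nonneg (convex_Ioc 0 c)
    (fun x hx => (hasDerivAt_log_one_add_div_sqrt hx.1).continuousAt.continuousWithinAt)
    (fun x hx => (hasDerivAt_log_one_add_div_sqrt (interior_subset hx).1).hasDerivWithinAt)
    (fun x hx => ?_)
  obtain ⟨hx0, hxc⟩ := interior_subset hx
  exact div_nonneg (sub_nonneg.2 (one_add_mul_log_one_add_le hc hx0.le hxc)) (by positivity)

lemma antitoneOn_log_one_add_div_sqrt {c : ℝ} (hc0 : 0 < c)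
    (hc : 2 * c = (1 + c) * Real.log (1 + c)) :
    AntitoneOn (fun y : ℝ => Real.log (1 + y) / √y) (Ici c) := by
  refine antitoneOn_of_hasDerivWithinAt_nonpos (convex_Ici c)
    (fun x hx => (hasDerivAt_log_one_add_div_sqrt
      (hc0.trans_le hx)).continuousAt.continuousWithinAt)
    (fun x hx => (hasDerivAt_log_one_add_div_sqrt
      (hc0.trans_le (interior_subset hx))).hasDerivWithinAt)
    (fun x hx => ?_)
  rw [interior_Ici] at hx
  have hx0 : 0 < x := hc0.trans hx
  exact div_nonpos_of_nonpos_of_nonneg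
    (sub_nonpos.2 (le_one_add_mul_log_one_add hc0 hc hx)) (by positivity)

/-- The ratio `log (1 + x) / √x` is still at least `a` at `x = (4 / a²) log² (2 / a)`. -/
lemma le_log_one_add_div_sqrt_of_one_le_log {a : ℝ} (ha : 0 < a)
    (hL : 1 ≤ Real.log (2 / a)) :
    a ≤ Real.log (1 + (2 * Real.log (2 / a) / a) ^ 2) / √((2 * Real.log (2 / a) / a) ^ 2) := by
  have hpos : 0 < 2 * Real.log (2 / a) / a := by positivity
  rw [Real.sqrt_sq hpos.le, le_div_iff₀ hpos, mul_div_cancel₀ _ ha.ne']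
  have h2 : 2 * Real.log (2 / a) = Real.log ((2 / a) ^ 2) := by
    rw [Real.log_pow]; norm_num
  refine h2.trans_le (Real.log_le_log (by positivity) ?_)
  have : 2 / a ≤ 2 * Real.log (2 / a) / a := by gcongr; linarith
  have := pow_le_pow_left₀ (by positivity) this 2
  linarith


/-- let `c ∈ [3.92, 3.93]` be the unique positive solution of
`2c = (1+c)ln(1+c)`.  If `A > 0`, `B ≥ 1`, `ln(1 + 1/B) ≥ A` and
`A√B ≤ (ln c)/√(2c)`, then every `T ∈ ℕ` (positive) with
`ln(1 + T/B)/√T < A` satisfies `T ≥ ⌈(4/A²)·ln²(2/(A√B))⌉`; i.e. the first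
time the ratio drops below `A` is at least `⌈(4/A²)·ln²(2/(A√B))⌉`. -/
theorem first_time_log_ratio_below (c A B : ℝ)
    (hc0 : 0 < c) (hc1 : 3.92 ≤ c) (hc2 : c ≤ 3.93)
    (hc : 2 * c = (1 + c) * Real.log (1 + c))
    (hA : 0 < A) (hB : 1 ≤ B)
    (h1 : A ≤ Real.log (1 + 1 / B))
    (h2 : A * Real.sqrt B ≤ Real.log c / Real.sqrt (2 * c)) :
    ∀ T : ℕ, 1 ≤ T → Real.log (1 + (T : ℝ) / B) / Real.sqrt (T : ℝ) < A →
      ⌈4 / A ^ 2 * (Real.log (2 / (A * Real.sqrt B))) ^ 2⌉₊ ≤ T := by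
  intro T hT hlt
  have hB0 : 0 < B := by linarith
  have hT1 : (1 : ℝ) ≤ T := by exact_mod_cast hT
  have hT0 : (0 : ℝ) < T := by linarith
  have hsB : 0 < √B := Real.sqrt_pos.2 hB0
  set a : ℝ := A * √B with ha_def
  have ha : 0 < a := by positivity
  have hlogc : Real.log c ≤ 1.4 := by
    have h4 : Real.log c ≤ Real.log (2 ^ 2) := Real.log_le_log hc0 (by norm_num; linarith)
    rw [Real.log_pow] at h4
    have := Real.log_two_lt_d9
    push_cast at h4
    linarith
  have ha_half : a ≤ 1 / 2 := by
    have hs : 2.8 ≤ √(2 * c) := Real.le_sqrt_of_sq_le (by norm_num; linarith)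
    refine h2.trans ((div_le_iff₀ (by linarith)).2 (by linarith))
  have hL : 1 ≤ Real.log (2 / a) := by
    rw [Real.le_log_iff_exp_le (by positivity), le_div_iff₀ ha]
    have := Real.exp_one_lt_d9
    nlinarith [Real.exp_pos 1]
  have hstart : a ≤ Real.log (1 + 1 / B) / √(1 / B) := by
    rw [Real.sqrt_div zero_le_one, Real.sqrt_one, div_div_eq_mul_div, div_one]
    exact mul_le_mul_of_nonneg_right h1 hsB.le
  have hratio : Real.log (1 + T / B) / √(T / B) < a := by
    rw [Real.sqrt_div hT0.le, div_div_eq_mul_div, mul_div_right_comm]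
    exact mul_lt_mul_of_pos_right hlt hsB
  have hx1 : 1 / B ≤ T / B := by gcongr
  have hx0 : 0 < 1 / B := by positivity
  have hcx : c < T / B := by
    by_contra! hxc
    exact hratio.not_ge (hstart.trans (monotoneOn_log_one_add_div_sqrt hc
      ⟨hx0, hx1.trans hxc⟩ ⟨hx0.trans_le hx1, hxc⟩ hx1))
  refine Nat.ceil_le.2 ?_
  by_contra! hlarge
  have hxstar : T / B ≤ (2 * Real.log (2 / a) / a) ^ 2 := by
    have heq : (2 * Real.log (2 / a) / a) ^ 2 = 4 / A ^ 2 * Real.log (2 / a) ^ 2 / B := by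
      have hsq : a ^ 2 = A ^ 2 * B := by rw [ha_def, mul_pow, Real.sq_sqrt hB0.le]
      rw [div_pow, hsq]
      field_simp
      norm_num
    rw [heq]
    exact div_le_div_of_nonneg_right hlarge.le hB0.le
  exact hratio.not_ge ((le_log_one_add_div_sqrt_of_one_le_log ha hL).trans
    (antitoneOn_log_one_add_div_sqrt hc0 hc hcx.le (hcx.le.trans hxstar) hxstar))
end

section
/- For every real number A > 0, the infimum over η > 0 of 1/η + η·ln²(Aη) is at least ln A; that is, for all η > 0, 1/η + η·ln²(Aη) ≥ ln A. -/
/-- For every real `A > 0` and every `η > 0`,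
`1/η + η·ln²(Aη) ≥ ln A`. -/
theorem inf_one_div_add_mul_log_sq_ge_log (A : ℝ) (hA : 0 < A) :
    ∀ η : ℝ, 0 < η → Real.log A ≤ 1 / η + η * (Real.log (A * η)) ^ 2 := by
  intro η hη
  have hsplit : Real.log (A * η) = Real.log A + Real.log η :=
    Real.log_mul hA.ne' hη.ne'
  have hlog : -Real.log η ≤ 3 / 4 * (1 / η) := by
    have h₁ : Real.log (3 / 4 * (1 / η)) ≤ 3 / 4 * (1 / η) - 1 :=
      Real.log_le_sub_one_of_pos (by positivity)
    have h₂ : Real.log (4 / 3) ≤ 4 / 3 - 1 := Real.log_le_sub_one_of_pos (by norm_num)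
    have h₃ : Real.log (4 / 3) = -Real.log (3 / 4) := by
      rw [← Real.log_inv]
      norm_num
    rw [Real.log_mul (by norm_num) (by positivity), one_div, Real.log_inv] at h₁
    rw [one_div]
    linarith
  have hsq : 0 ≤ η * (Real.log (A * η) - 1 / (2 * η)) ^ 2 := by positivity
  have hexpand : η * (Real.log (A * η) - 1 / (2 * η)) ^ 2 =
      η * Real.log (A * η) ^ 2 - Real.log (A * η) + 1 / 4 * (1 / η) := by
    field_simp
    ring
  linarith
end
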